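/- arXiv:1312.2848 — 3 statements merged into one kernel-verified Lean document; each statement's English description precedes it below -/
import Mathlib

section
/- Let T = [A,B,C]_R be an I×J×K real tensor. Suppose that k_A + r_B + r_C ≥ 2R + 2 and min(r_C + k_B, k_C + r_B) ≥ R + 2. Then the rank of T equals R and the CPD of T is unique. -/
open scoped BigOperators

noncomputable section

/-- The k-rank of a matrix: the largest `k` such that every subset of `k` columns is
linearly independent. -/
noncomputable def kRank {α β : Type*} [Fintype α] [Fintype β] (A : Matrix α β ℝ) : ℕ :=
  sSup {k | k ≤ Fintype.card β ∧
    ∀ s : Finset β, s.card = k → LinearIndependent ℝ fun j : s => fun i : α => A i j.1}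

/-- The `I × J × K` tensor `[A, B, C]_R` built from factor matrices `A`, `B`, `C`:
`t i j k = ∑ r, A i r * B j r * C k r`. -/
def cpdTensor {I J K R : ℕ} (A : Matrix (Fin I) (Fin R) ℝ) (B : Matrix (Fin J) (Fin R) ℝ)
    (C : Matrix (Fin K) (Fin R) ℝ) : Fin I → Fin J → Fin K → ℝ :=
  fun i j k => ∑ r, A i r * B j r * C k r

/-- The rank of a third-order tensor: the minimal number of rank-1 terms whose sum is `T`. -/
noncomputable def tensorRank {I J K : ℕ} (T : Fin I → Fin J → Fin K → ℝ) : ℕ :=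
  sInf {n | ∃ A B C, T = cpdTensor (R := n) A B C}

/-- Uniqueness of the CPD with `R` terms: any two representations of `T` as a sum of `R`
rank-1 terms coincide up to a common permutation of the terms and scalings of the columns
whose product is `1` within each term. -/
def cpdUnique {I J K : ℕ} (R : ℕ) (T : Fin I → Fin J → Fin K → ℝ) : Prop :=
  ∀ (A A' : Matrix (Fin I) (Fin R) ℝ) (B B' : Matrix (Fin J) (Fin R) ℝ)
    (C C' : Matrix (Fin K) (Fin R) ℝ),
    T = cpdTensor A B C → T = cpdTensor A' B' C' →
    ∃ (σ : Equiv.Perm (Fin R)) (la lb lc : Fin R → ℝ),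
      (∀ r, la r * lb r * lc r = 1) ∧
      (∀ i r, A' i r = la r * A i (σ r)) ∧
      (∀ j r, B' j r = lb r * B j (σ r)) ∧
      (∀ k r, C' k r = lc r * C k (σ r))


section ProductFamilies

open Module Submodule

variable {𝕜 ι κ V W : Type*} [Field 𝕜] [AddCommGroup V] [Module 𝕜 V]
  [AddCommGroup W] [Module 𝕜 W]

/-- The dimension of the span of the members of a family indexed by a finite set. -/
def familyRank (𝕜 : Type*) {ι V : Type*} [Field 𝕜] [AddCommGroup V] [Module 𝕜 V]
    (v : ι → V) (S : Finset ι) : ℕ :=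
  finrank 𝕜 (span 𝕜 (v '' S))

instance finiteDimensional_span_image_finset (v : ι → V) (S : Finset ι) :
    FiniteDimensional 𝕜 (span 𝕜 (v '' S)) :=
  FiniteDimensional.span_of_finite 𝕜 (S.finite_toSet.image v)

lemma span_image_union [DecidableEq ι] (v : ι → V) (S N : Finset ι) :
    span 𝕜 (v '' ↑(S ∪ N)) = span 𝕜 (v '' S) ⊔ span 𝕜 (v '' N) := by
  rw [Finset.coe_union, Set.image_union, span_union]

lemma familyRank_mono (v : ι → V) {S T : Finset ι} (h : S ⊆ T) :
    familyRank 𝕜 v S ≤ familyRank 𝕜 v T :=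
  finrank_mono (span_mono (Set.image_mono (Finset.coe_subset.2 h)))

lemma familyRank_le_card (v : ι → V) (S : Finset ι) : familyRank 𝕜 v S ≤ S.card := by
  classical
  rw [familyRank, ← Finset.coe_image]
  exact (finrank_span_finset_le_card _).trans Finset.card_image_le

lemma familyRank_eq_card {v : ι → V} {S : Finset ι} (h : LinearIndepOn 𝕜 v (S : Set ι)) :
    familyRank 𝕜 v S = S.card := by
  rw [familyRank, Set.image_eq_range]
  exact (finrank_span_eq_card h).trans (Fintype.card_coe S)

lemma familyRank_union_add_inf [DecidableEq ι] (v : ι → V) (S N : Finset ι) :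
    familyRank 𝕜 v (S ∪ N) + finrank 𝕜 ↥(span 𝕜 (v '' S) ⊓ span 𝕜 (v '' N)) =
      familyRank 𝕜 v S + familyRank 𝕜 v N := by
  rw [familyRank, span_image_union]
  exact finrank_sup_add_finrank_inf_eq _ _

lemma familyRank_union_le [DecidableEq ι] (v : ι → V) (S N : Finset ι) :
    familyRank 𝕜 v (S ∪ N) ≤ familyRank 𝕜 v S + familyRank 𝕜 v N :=
  (Nat.le_add_right _ _).trans (familyRank_union_add_inf v S N).le

lemma familyRank_lt_card_of_sum_eq_zero {v : ι → V} {S : Finset ι} (hS : S.Nonempty)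
    (h : ∑ i ∈ S, v i = 0) : familyRank 𝕜 v S < S.card := by
  classical
  obtain ⟨e, he⟩ := hS
  have hspan : span 𝕜 (v '' S) ≤ span 𝕜 (v '' ↑(S.erase e)) := by
    rw [span_le]
    rintro _ ⟨i, hi, rfl⟩
    by_cases hie : i = e
    · subst hie
      have : v i = -∑ j ∈ S.erase i, v j :=
        eq_neg_of_add_eq_zero_left ((Finset.add_sum_erase S v he).trans h)
      rw [this]
      exact neg_mem (sum_mem fun j hj => subset_span ⟨j, hj, rfl⟩)
    · exact subset_span ⟨i, Finset.mem_coe.2 (Finset.mem_erase.2 ⟨hie, hi⟩), rfl⟩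
  calc familyRank 𝕜 v S ≤ familyRank 𝕜 v (S.erase e) := finrank_mono hspan
    _ ≤ (S.erase e).card := familyRank_le_card _ _
    _ < S.card := Finset.card_erase_lt_of_mem he

/-- A family splits over a finite index set if the set can be divided into two nonempty parts
whose spans are independent. -/
def Splits (𝕜 : Type*) {ι V : Type*} [Field 𝕜] [AddCommGroup V] [Module 𝕜 V] [DecidableEq ι]
    (v : ι → V) (T : Finset ι) : Prop :=
  ∃ S ⊆ T, S.Nonempty ∧ (T \ S).Nonempty ∧
    Disjoint (span 𝕜 (v '' S)) (span 𝕜 (v '' ↑(T \ S)))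

/-- The coordinate form of the product of a vector of `κ → 𝕜` and a vector of `W`. -/
def outer (x : κ → 𝕜) (y : W) : κ → W := fun i => x i • y

lemma Splits.outer [DecidableEq ι] {y : ι → W} {T : Finset ι} (x : ι → κ → 𝕜)
    (h : Splits 𝕜 y T) : Splits 𝕜 (fun a => outer (x a) (y a)) T := by
  obtain ⟨S, hST, hS, hS', hd⟩ := h
  refine ⟨S, hST, hS, hS', ?_⟩
  have key (U : Finset ι) (t : κ → W)
      (ht : t ∈ span 𝕜 ((fun a => _root_.outer (x a) (y a)) '' U)) (i : κ) :
      t i ∈ span 𝕜 (y '' U) := by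
    rw [mem_span_image_finset_iff_exists_fun'] at ht
    obtain ⟨c, rfl⟩ := ht
    rw [Finset.sum_apply]
    exact sum_mem fun a ha => smul_mem _ _ (smul_mem _ _ (subset_span ⟨a, ha, rfl⟩))
  rw [disjoint_def] at hd ⊢
  intro t h1 h2
  ext i
  exact hd _ (key _ _ h1 i) (key _ _ h2 i)

/-- If `∑ b ∈ N, (c b * φ (x b)) • y b` vanishes, with nonzero coefficients `c b`, for every
functional `φ` vanishing on `P`, then the ranks of `x` modulo `P` and of `y` over `N` sum to at
most the size of `N`. -/
lemma finrank_sup_add_familyRank_le [FiniteDimensional 𝕜 V] (x : ι → V) (y : ι → W)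
    (c : ι → 𝕜) (N : Finset ι) (P : Submodule 𝕜 V) (hc : ∀ b ∈ N, c b ≠ 0)
    (h : ∀ φ ∈ P.dualAnnihilator, ∑ b ∈ N, (c b * φ (x b)) • y b = 0) :
    finrank 𝕜 ↥(P ⊔ span 𝕜 (x '' N)) + familyRank 𝕜 y N ≤ finrank 𝕜 P + N.card := by
  set Q := P ⊔ span 𝕜 (x '' N) with hQ
  let L : (N → 𝕜) →ₗ[𝕜] W := Fintype.linearCombination 𝕜 (fun b : N => y b)
  let Φ : Dual 𝕜 V →ₗ[𝕜] (N → 𝕜) :=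
    LinearMap.pi fun b : N => c b • Dual.eval 𝕜 V (x b)
  let Ψ := Φ.domRestrict P.dualAnnihilator
  have hL : familyRank 𝕜 y N + finrank 𝕜 (LinearMap.ker L) = N.card := by
    have := LinearMap.finrank_range_add_finrank_ker L
    rw [Fintype.range_linearCombination, finrank_fintype_fun_eq_card, Fintype.card_coe] at this
    rwa [familyRank, Set.image_eq_range]
  have hrange : finrank 𝕜 (LinearMap.range Ψ) ≤ finrank 𝕜 (LinearMap.ker L) := by
    apply finrank_mono
    rintro _ ⟨⟨φ, hφ⟩, rfl⟩
    rw [LinearMap.mem_ker, Fintype.linearCombination_apply, ← h φ hφ,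
      ← Finset.sum_coe_sort N]
    rfl
  have hker : finrank 𝕜 (LinearMap.ker Ψ) ≤ finrank 𝕜 Q.dualAnnihilator := by
    rw [← finrank_map_subtype_eq P.dualAnnihilator (LinearMap.ker Ψ)]
    apply finrank_mono
    rintro _ ⟨⟨φ, hφ⟩, hφ', rfl⟩
    rw [hQ, dualAnnihilator_sup_eq]
    refine ⟨hφ, ?_⟩
    rw [SetLike.mem_coe, mem_dualAnnihilator]
    intro v hv
    have hle : span 𝕜 (x '' N) ≤ LinearMap.ker φ := by
      rw [span_le]
      rintro _ ⟨b, hb, rfl⟩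
      have h0 : c b * φ (x b) = 0 := congrFun hφ' ⟨b, hb⟩
      exact (mul_eq_zero.1 h0).resolve_left (hc b hb)
    exact hle hv
  have h1 := LinearMap.finrank_range_add_finrank_ker (V := P.dualAnnihilator) Ψ
  have h2 := Subspace.finrank_add_finrank_dualAnnihilator_eq P
  have h3 := Subspace.finrank_add_finrank_dualAnnihilator_eq Q
  omega

lemma sum_single_smul_outer [Fintype κ] [DecidableEq κ] (φ : Dual 𝕜 (κ → 𝕜)) (x : κ → 𝕜)
    (y : W) : ∑ i, φ (Pi.single i 1) • outer x y i = φ x • y := by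
  rw [LinearMap.pi_apply_eq_sum_univ φ x, Finset.sum_smul]
  refine Finset.sum_congr rfl fun i _ => ?_
  have : (fun j => if i = j then (1 : 𝕜) else 0) = Pi.single i 1 := by
    ext j
    simp [Pi.single_apply, eq_comm]
  rw [outer, smul_smul, smul_eq_mul, mul_comm, this]

/-- Contraction of the first factor with a functional. -/
def contract [Fintype κ] [DecidableEq κ] (W : Type*) [AddCommGroup W] [Module 𝕜 W]
    (φ : Dual 𝕜 (κ → 𝕜)) : (κ → W) →ₗ[𝕜] W :=
  ∑ i, φ (Pi.single i 1) • LinearMap.proj i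

lemma contract_outer [Fintype κ] [DecidableEq κ] (φ : Dual 𝕜 (κ → 𝕜)) (x : κ → 𝕜) (y : W) :
    contract W φ (outer x y) = φ x • y := by
  rw [← sum_single_smul_outer, contract, LinearMap.sum_apply]
  rfl

/-- If the spans of a product family over `S` and `M` meet, then `S` can be enlarged by elements
of `M` so that the sum of the ranks of the factors grows at most as fast as the rank of the
products. -/
lemma exists_extension [Finite κ] [DecidableEq ι] (x : ι → κ → 𝕜) (y : ι → W)
    (S M : Finset ι)
    (h : ¬ Disjoint (span 𝕜 ((fun a => outer (x a) (y a)) '' S))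
      (span 𝕜 ((fun a => outer (x a) (y a)) '' M))) :
    ∃ N ⊆ M, N.Nonempty ∧
      familyRank 𝕜 x (S ∪ N) + familyRank 𝕜 y (S ∪ N) +
        familyRank 𝕜 (fun a => outer (x a) (y a)) S ≤
      familyRank 𝕜 x S + familyRank 𝕜 y S +
        familyRank 𝕜 (fun a => outer (x a) (y a)) (S ∪ N) := by
  classical
  have := Fintype.ofFinite κ
  set z := fun a => outer (x a) (y a)
  obtain ⟨N, hN⟩ := Finset.exists_minimal (s := M.powerset.filter fun N : Finset ι =>
    ¬ Disjoint (span 𝕜 (z '' S)) (span 𝕜 (z '' N))) ⟨M, by simpa using h⟩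
  have hNM : N ⊆ M := by
    simpa using (Finset.mem_filter.1 hN.prop).1
  have hNd := (Finset.mem_filter.1 hN.prop).2
  have hmin (b : ι) (hb : b ∈ N) :
      Disjoint (span 𝕜 (z '' S)) (span 𝕜 (z '' ↑(N.erase b))) := by
    by_contra hcon
    have := hN.le_of_le (Finset.mem_filter.2
      ⟨Finset.mem_powerset.2 ((Finset.erase_subset b N).trans hNM), hcon⟩)
      (Finset.erase_subset b N)
    exact Finset.notMem_erase b N (this hb)
  have hne : N.Nonempty := by
    rw [Finset.nonempty_iff_ne_empty]
    rintro rfl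
    simp at hNd
  have hind : LinearIndepOn 𝕜 z (N : Set ι) := by
    rw [linearIndepOn_iff_notMem_span]
    intro b hb hmem
    rw [← Finset.coe_erase] at hmem
    refine hNd ((hmin b hb).mono_right (span_le.2 ?_))
    rintro _ ⟨a, ha, rfl⟩
    by_cases hab : a = b
    · rwa [hab]
    · exact subset_span ⟨a, Finset.mem_coe.2 (Finset.mem_erase.2 ⟨hab, ha⟩), rfl⟩
  obtain ⟨e, he⟩ := hne
  have hzrank : familyRank 𝕜 z S + N.card ≤ familyRank 𝕜 z (S ∪ N) + 1 := by
    have h1 := familyRank_union_add_inf (𝕜 := 𝕜) z S (N.erase e)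
    rw [(hmin e he).eq_bot, finrank_bot, add_zero, familyRank_eq_card
      (hind.mono (Finset.coe_subset.2 (Finset.erase_subset e N)))] at h1
    have h2 : familyRank 𝕜 z (S ∪ N.erase e) ≤ familyRank 𝕜 z (S ∪ N) :=
      familyRank_mono z (Finset.union_subset_union_right (Finset.erase_subset e N))
    have h3 := Finset.card_erase_add_one he
    omega
  rw [disjoint_def] at hNd
  push Not at hNd
  obtain ⟨v, hvS, hvN, hv0⟩ := hNd
  obtain ⟨d, hd⟩ := (mem_span_image_finset_iff_exists_fun' 𝕜).1 hvS
  obtain ⟨c, hc⟩ := (mem_span_image_finset_iff_exists_fun' 𝕜).1 hvN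
  have hc0 (b : ι) (hb : b ∈ N) : c b ≠ 0 := by
    intro hcb
    refine hv0 ((disjoint_def.1 (hmin b hb)) v hvS ?_)
    rw [← hc, ← Finset.add_sum_erase N _ hb, hcb, zero_smul, zero_add]
    exact sum_mem fun a ha => smul_mem _ _ (subset_span ⟨a, ha, rfl⟩)
  have hx := finrank_sup_add_familyRank_le x y c N (span 𝕜 (x '' S)) hc0 (by
    intro φ hφ
    have h1 : contract W φ v = 0 := by
      rw [← hd, map_sum]
      refine Finset.sum_eq_zero fun a ha => ?_
      rw [map_smul, contract_outer,
        (mem_dualAnnihilator φ).1 hφ _ (subset_span ⟨a, ha, rfl⟩), zero_smul, smul_zero]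
    rw [← h1, ← hc, map_sum]
    refine Finset.sum_congr rfl fun a _ => ?_
    rw [map_smul, contract_outer, smul_smul])
  have hy : familyRank 𝕜 y (S ∪ N) + 1 ≤ familyRank 𝕜 y S + familyRank 𝕜 y N := by
    rw [← familyRank_union_add_inf]
    refine Nat.add_le_add_left (one_le_finrank_iff.2 ?_) _
    obtain ⟨i, hi⟩ := Function.ne_iff.1 hv0
    have key (U : Finset ι) (f : ι → 𝕜) (hf : ∑ a ∈ U, f a • z a = v) :
        v i ∈ span 𝕜 (y '' U) := by
      rw [← hf, Finset.sum_apply]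
      exact sum_mem fun a ha => smul_mem _ _ (smul_mem _ _ (subset_span ⟨a, ha, rfl⟩))
    exact (Submodule.ne_bot_iff _).2 ⟨v i, ⟨key S d hd, key N c hc⟩, hi⟩
  rw [← span_image_union] at hx
  change familyRank 𝕜 x (S ∪ N) + _ ≤ familyRank 𝕜 x S + _ at hx
  exact ⟨N, hNM, ⟨e, he⟩, by omega⟩

lemma familyRank_singleton_add_le (x : ι → κ → 𝕜) (y : ι → W) (a : ι) :
    familyRank 𝕜 x {a} + familyRank 𝕜 y {a} ≤
      familyRank 𝕜 (fun a => outer (x a) (y a)) {a} + 1 := by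
  have hx := familyRank_le_card (𝕜 := 𝕜) x {a}
  have hy := familyRank_le_card (𝕜 := 𝕜) y {a}
  rw [Finset.card_singleton] at hx hy
  by_cases hxa : x a = 0
  · have : familyRank 𝕜 x {a} = 0 := by simp [familyRank, hxa]
    omega
  by_cases hya : y a = 0
  · have : familyRank 𝕜 y {a} = 0 := by simp [familyRank, hya]
    omega
  have hz : outer (x a) (y a) ≠ 0 := by
    obtain ⟨i, hi⟩ := Function.ne_iff.1 hxa
    exact Function.ne_iff.2 ⟨i, smul_ne_zero hi hya⟩
  have : familyRank 𝕜 (fun a => outer (x a) (y a)) {a} = 1 := by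
    rw [familyRank, Finset.coe_singleton, Set.image_singleton]
    exact finrank_span_singleton hz
  omega

/-- A nonempty product family that does not split has rank at least the sum of the ranks of its
two factors minus one. -/
lemma familyRank_add_le_of_not_splits [Finite κ] [DecidableEq ι] (x : ι → κ → 𝕜) (y : ι → W)
    {T : Finset ι} (hT : T.Nonempty) (h : ¬ Splits 𝕜 (fun a => outer (x a) (y a)) T) :
    familyRank 𝕜 x T + familyRank 𝕜 y T ≤
      familyRank 𝕜 (fun a => outer (x a) (y a)) T + 1 := by
  classical
  obtain ⟨a, ha⟩ := hT
  obtain ⟨S, hS⟩ := Finset.exists_maximal (s := T.powerset.filter fun S => S.Nonempty ∧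
    familyRank 𝕜 x S + familyRank 𝕜 y S ≤ familyRank 𝕜 (fun a => outer (x a) (y a)) S + 1)
    ⟨{a}, by simpa [ha] using familyRank_singleton_add_le x y a⟩
  obtain ⟨hST, hSne, hSle⟩ := Finset.mem_filter.1 hS.prop
  rw [Finset.mem_powerset] at hST
  rcases (T \ S).eq_empty_or_nonempty with hTS | hTS
  · rwa [Finset.Subset.antisymm hST (Finset.sdiff_eq_empty_iff_subset.1 hTS)] at hSle
  obtain ⟨N, hN, ⟨b, hb⟩, hle⟩ := exists_extension x y S (T \ S)
    fun hd => h ⟨S, hST, hSne, hTS, hd⟩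
  have := hS.le_of_ge (y := S ∪ N) (Finset.mem_filter.2
    ⟨Finset.mem_powerset.2 (Finset.union_subset hST (hN.trans Finset.sdiff_subset)),
      hSne.mono Finset.subset_union_left, by omega⟩) Finset.subset_union_left
  exact absurd (this (Finset.mem_union_right S hb)) (Finset.mem_sdiff.1 (hN hb)).2

/-- A zero-sum family that splits divides into two zero-sum subfamilies. -/
lemma sum_eq_zero_of_disjoint_span [DecidableEq ι] {v : ι → V} {S T : Finset ι} (hST : S ⊆ T)
    (hd : Disjoint (span 𝕜 (v '' S)) (span 𝕜 (v '' ↑(T \ S)))) (h : ∑ a ∈ T, v a = 0) :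
    ∑ a ∈ S, v a = 0 ∧ ∑ a ∈ T \ S, v a = 0 := by
  have hsum : ∑ a ∈ T \ S, v a + ∑ a ∈ S, v a = 0 := (Finset.sum_sdiff hST).trans h
  have h0 : ∑ a ∈ S, v a = 0 := by
    refine disjoint_def.1 hd _ (sum_mem fun a ha => subset_span ⟨a, ha, rfl⟩) ?_
    rw [eq_neg_of_add_eq_zero_right hsum]
    exact neg_mem (sum_mem fun a ha => subset_span ⟨a, ha, rfl⟩)
  exact ⟨h0, by rwa [h0, add_zero] at hsum⟩

end ProductFamilies

section Matching

variable {𝕜 ι ι' κ₁ κ₂ κ₃ : Type*} [Field 𝕜]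

/-- The product of three coordinate vectors. -/
def outer₃ (a : κ₁ → 𝕜) (b : κ₂ → 𝕜) (c : κ₃ → 𝕜) : κ₁ → κ₂ → κ₃ → 𝕜 := outer a (outer b c)

lemma outer₃_apply (a : κ₁ → 𝕜) (b : κ₂ → 𝕜) (c : κ₃ → 𝕜) (i : κ₁) (j : κ₂) (k : κ₃) :
    outer₃ a b c i j k = a i * b j * c k := (mul_assoc _ _ _).symm

lemma familyRank_add_add_le_of_not_splits [Finite κ₁] [Finite κ₂] [DecidableEq ι]
    (a : ι → κ₁ → 𝕜) (b : ι → κ₂ → 𝕜) (c : ι → κ₃ → 𝕜) {T : Finset ι} (hT : T.Nonempty)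
    (h : ¬ Splits 𝕜 (fun r => outer₃ (a r) (b r) (c r)) T) :
    familyRank 𝕜 a T + familyRank 𝕜 b T + familyRank 𝕜 c T ≤
      familyRank 𝕜 (fun r => outer₃ (a r) (b r) (c r)) T + 2 := by
  have h1 := familyRank_add_le_of_not_splits a (fun r => outer (b r) (c r)) hT h
  have h2 := familyRank_add_le_of_not_splits b c hT fun hs => h (hs.outer a)
  unfold outer₃
  omega

lemma familyRank_toLeft_le {V : Type*} [AddCommGroup V] [Module 𝕜 V] (v : ι → V) (w : ι' → V)
    (T : Finset (ι ⊕ ι')) : familyRank 𝕜 v T.toLeft ≤ familyRank 𝕜 (Sum.elim v w) T := by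
  refine Submodule.finrank_mono (Submodule.span_mono ?_)
  rintro _ ⟨i, hi, rfl⟩
  exact ⟨Sum.inl i, Finset.mem_toLeft.1 hi, rfl⟩

lemma val_add_val_sdiff [DecidableEq ι] {S T : Finset ι} (h : S ⊆ T) :
    S.val + (T \ S).val = T.val := by
  rw [Finset.sdiff_val, add_tsub_cancel_of_le (Finset.val_le_iff.2 h)]

/-- If the ranks of the factors of the first family are large on every subset, then each
relation between the two families with no more terms from the second family than from the first
one comes from a matching of equal terms. -/
lemma map_outer₃_eq_map_outer₃ [Finite κ₁] [Finite κ₂] [DecidableEq ι] [DecidableEq ι']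
    (a : ι → κ₁ → 𝕜) (b : ι → κ₂ → 𝕜) (c : ι → κ₃ → 𝕜)
    (a' : ι' → κ₁ → 𝕜) (b' : ι' → κ₂ → 𝕜) (c' : ι' → κ₃ → 𝕜)
    (hne : ∀ r, outer₃ (a r) (b r) (c r) ≠ 0)
    (h : ∀ S : Finset ι, 2 ≤ S.card →
      2 * S.card + 2 ≤ familyRank 𝕜 a S + familyRank 𝕜 b S + familyRank 𝕜 c S)
    (T : Finset (ι ⊕ ι')) (hcard : T.toRight.card ≤ T.toLeft.card)
    (hsum : ∑ r ∈ T.toLeft, outer₃ (a r) (b r) (c r) =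
      ∑ s ∈ T.toRight, outer₃ (a' s) (b' s) (c' s)) :
    T.toRight.val.map (fun s => outer₃ (a' s) (b' s) (c' s)) =
      T.toLeft.val.map (fun r => outer₃ (a r) (b r) (c r)) := by
  let u : ι ⊕ ι' → κ₁ → 𝕜 := Sum.elim a (fun s => -a' s)
  let v : ι ⊕ ι' → κ₂ → 𝕜 := Sum.elim b b'
  let w : ι ⊕ ι' → κ₃ → 𝕜 := Sum.elim c c'
  let z : ι ⊕ ι' → κ₁ → κ₂ → κ₃ → 𝕜 := fun t => outer₃ (u t) (v t) (w t)
  have hz (T : Finset (ι ⊕ ι')) : ∑ t ∈ T, z t = 0 ↔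
      ∑ r ∈ T.toLeft, outer₃ (a r) (b r) (c r) =
        ∑ s ∈ T.toRight, outer₃ (a' s) (b' s) (c' s) := by
    have hinr (s : ι') : z (Sum.inr s) = -outer₃ (a' s) (b' s) (c' s) := by
      ext i j k
      simp [z, u, v, w, outer₃_apply]
    rw [Finset.sum_sum_eq_sum_toLeft_add_sum_toRight, ← sub_eq_zero (b := ∑ s ∈ T.toRight, _),
      sub_eq_add_neg, ← Finset.sum_neg_distrib]
    simp only [hinr]
    rfl
  induction T using Finset.strongInduction with
  | H T ih =>
  rcases Nat.lt_or_ge T.toLeft.card 2 with hlt | hge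
  · obtain h0 | h1 : T.toLeft.card = 0 ∨ T.toLeft.card = 1 := by omega
    · have h0' : T.toRight.card = 0 := by omega
      rw [Finset.card_eq_zero] at h0 h0'
      rw [h0, h0']
      rfl
    · obtain ⟨r, hr⟩ := Finset.card_eq_one.1 h1
      obtain h2 | h2 : T.toRight.card = 0 ∨ T.toRight.card = 1 := by omega
      · rw [Finset.card_eq_zero] at h2
        rw [hr, h2, Finset.sum_singleton, Finset.sum_empty] at hsum
        exact absurd hsum (hne r)
      · obtain ⟨s, hs⟩ := Finset.card_eq_one.1 h2
        rw [hr, hs, Finset.sum_singleton, Finset.sum_singleton] at hsum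
        rw [hr, hs]
        simp [hsum]
  · have hTcard := Finset.card_toLeft_add_card_toRight (u := T)
    have hTne : T.Nonempty := Finset.card_pos.1 (by omega)
    have hsplit : Splits 𝕜 z T := by
      by_contra hns
      have h1 := familyRank_add_add_le_of_not_splits u v w hTne hns
      have h2 : familyRank 𝕜 z T < T.card :=
        familyRank_lt_card_of_sum_eq_zero hTne ((hz T).2 hsum)
      have h3 := h T.toLeft hge
      have h4 : familyRank 𝕜 a T.toLeft ≤ familyRank 𝕜 u T := familyRank_toLeft_le _ _ _
      have h5 : familyRank 𝕜 b T.toLeft ≤ familyRank 𝕜 v T := familyRank_toLeft_le _ _ _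
      have h6 : familyRank 𝕜 c T.toLeft ≤ familyRank 𝕜 w T := familyRank_toLeft_le _ _ _
      change _ ≤ familyRank 𝕜 z T + 2 at h1
      omega
    obtain ⟨S, hST, hSne, hSne', hd⟩ := hsplit
    obtain ⟨hs1, hs2⟩ := sum_eq_zero_of_disjoint_span hST hd ((hz T).2 hsum)
    have hlt1 : S ⊂ T := hST.ssubset_of_not_subset (Finset.sdiff_nonempty.1 hSne')
    have hlt2 : T \ S ⊂ T := Finset.sdiff_ssubset hST hSne
    have ih1 := fun hc => ih S hlt1 hc ((hz S).1 hs1)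
    have ih2 := fun hc => ih (T \ S) hlt2 hc ((hz (T \ S)).1 hs2)
    have hl : S.toLeft.val + (T \ S).toLeft.val = T.toLeft.val := by
      rw [Finset.toLeft_sdiff, val_add_val_sdiff (Finset.toLeft_subset_toLeft hST)]
    have hr : S.toRight.val + (T \ S).toRight.val = T.toRight.val := by
      rw [Finset.toRight_sdiff, val_add_val_sdiff (Finset.toRight_subset_toRight hST)]
    have hlc : S.toLeft.card + (T \ S).toLeft.card = T.toLeft.card := by
      simpa using congrArg Multiset.card hl
    have hrc : S.toRight.card + (T \ S).toRight.card = T.toRight.card := by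
      simpa using congrArg Multiset.card hr
    rw [← hl, ← hr, Multiset.map_add, Multiset.map_add]
    rcases Nat.le_total S.toRight.card S.toLeft.card with hle | hle
    · have e1 := ih1 hle
      have := congrArg Multiset.card e1
      simp only [Multiset.card_map, Finset.card_val] at this
      rw [e1, ih2 (by omega)]
    · have e2 := ih2 (by omega)
      have := congrArg Multiset.card e2
      simp only [Multiset.card_map, Finset.card_val] at this
      rw [e2, ih1 (by omega)]

/-- Two finite families with the same multiset of values agree up to a bijection of the
indices. -/
lemma exists_equiv_of_map_univ_eq {α β γ : Type*} [Fintype α] [Fintype β] {f : α → γ} {g : β → γ}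
    (h : Finset.univ.val.map f = Finset.univ.val.map g) : ∃ e : α ≃ β, ∀ a, g (e a) = f a := by
  classical
  have hfib (c : γ) : Nonempty ({a // f a = c} ≃ {b // g b = c}) := by
    refine ⟨Fintype.equivOfCardEq ?_⟩
    have := congrArg (Multiset.count c) h
    rw [Multiset.count_map, Multiset.count_map] at this
    rw [Fintype.card_subtype, Fintype.card_subtype]
    change (Finset.univ.val.filter fun a => f a = c).card =
      (Finset.univ.val.filter fun b => g b = c).card
    simpa only [eq_comm] using this
  exact ⟨Equiv.ofFiberEquiv fun c => (hfib c).some, Equiv.ofFiberEquiv_map _⟩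

/-- Equal nonzero products of three vectors have factors that agree up to scalings with
product `1`. -/
lemma exists_scaling_of_outer₃_eq {a a' : κ₁ → 𝕜} {b b' : κ₂ → 𝕜} {c c' : κ₃ → 𝕜}
    (h0 : outer₃ a b c ≠ 0) (h : outer₃ a' b' c' = outer₃ a b c) :
    ∃ la lb lc : 𝕜, la * lb * lc = 1 ∧ (∀ i, a' i = la * a i) ∧ (∀ j, b' j = lb * b j) ∧
      ∀ k, c' k = lc * c k := by
  obtain ⟨i, hi⟩ := Function.ne_iff.1 h0
  obtain ⟨j, hj⟩ := Function.ne_iff.1 hi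
  obtain ⟨k, hk⟩ := Function.ne_iff.1 hj
  have heq (i : κ₁) (j : κ₂) (k : κ₃) : a' i * b' j * c' k = a i * b j * c k := by
    rw [← outer₃_apply, h, outer₃_apply]
  have hp : a i * b j * c k ≠ 0 := by rwa [← outer₃_apply]
  have hp' : a' i * b' j * c' k ≠ 0 := by rwa [heq]
  obtain ⟨⟨ha, hb⟩, hc⟩ : (a i ≠ 0 ∧ b j ≠ 0) ∧ c k ≠ 0 := by simpa [not_or] using hp
  obtain ⟨⟨ha', hb'⟩, hc'⟩ : (a' i ≠ 0 ∧ b' j ≠ 0) ∧ c' k ≠ 0 := by simpa [not_or] using hp'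
  refine ⟨a' i / a i, b' j / b j, c' k / c k, ?_, fun l => ?_, fun l => ?_, fun l => ?_⟩
  · rw [div_mul_div_comm, div_mul_div_comm, heq, div_self hp]
  · rw [div_mul_eq_mul_div, eq_div_iff ha]
    apply mul_right_cancel₀ (mul_ne_zero (mul_ne_zero hb hc) (mul_ne_zero hb' hc'))
    linear_combination (a i * b j * c k) * heq l j k - (a l * b j * c k) * heq i j k
  · rw [div_mul_eq_mul_div, eq_div_iff hb]
    apply mul_right_cancel₀ (mul_ne_zero (mul_ne_zero ha hc) (mul_ne_zero ha' hc'))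
    linear_combination (a i * b j * c k) * heq i l k - (a i * b l * c k) * heq i j k
  · rw [div_mul_eq_mul_div, eq_div_iff hc]
    apply mul_right_cancel₀ (mul_ne_zero (mul_ne_zero ha hb) (mul_ne_zero ha' hb'))
    linear_combination (a i * b j * c k) * heq i j l - (a i * b j * c l) * heq i j k

end Matching

section FactorMatrices

lemma kRank_mem {α β : Type*} [Fintype α] [Fintype β] (A : Matrix α β ℝ) :
    kRank A ≤ Fintype.card β ∧ ∀ s : Finset β, s.card = kRank A →
      LinearIndependent ℝ fun j : s => fun i : α => A i j.1 := by
  refine Nat.sSup_mem (s := {k | k ≤ Fintype.card β ∧ ∀ s : Finset β, s.card = k →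
    LinearIndependent ℝ fun j : s => fun i : α => A i j.1}) ⟨0, Nat.zero_le _, fun s hs => ?_⟩
    ⟨Fintype.card β, fun k hk => hk.1⟩
  rw [Finset.card_eq_zero] at hs
  subst hs
  exact linearIndependent_empty_type

lemma min_kRank_le_familyRank {α β : Type*} [Fintype α] [Fintype β] (A : Matrix α β ℝ)
    (S : Finset β) : min (kRank A) S.card ≤ familyRank ℝ A.col S := by
  classical
  obtain ⟨hle, hind⟩ := kRank_mem A
  rcases Nat.le_total (kRank A) S.card with h | h
  · obtain ⟨U, hUS, hU⟩ := Finset.exists_subset_card_eq h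
    calc min (kRank A) S.card ≤ U.card := hU ▸ min_le_left _ _
      _ = familyRank ℝ A.col U :=
        (familyRank_eq_card (show LinearIndepOn ℝ A.col (U : Set β) from hind U hU)).symm
      _ ≤ _ := familyRank_mono _ hUS
  · obtain ⟨U, hSU, hU⟩ := Finset.exists_superset_card_eq h hle
    have hU' : LinearIndepOn ℝ A.col (U : Set β) := hind U hU
    rw [familyRank_eq_card (hU'.mono (Finset.coe_subset.2 hSU))]
    exact min_le_right _ _

lemma rank_add_card_le_familyRank {α β : Type*} [Fintype α] [Fintype β] (A : Matrix α β ℝ)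
    (S : Finset β) : A.rank + S.card ≤ familyRank ℝ A.col S + Fintype.card β := by
  classical
  have h1 := familyRank_union_le (𝕜 := ℝ) A.col S Sᶜ
  rw [Finset.union_compl] at h1
  have h2 := familyRank_le_card (𝕜 := ℝ) A.col Sᶜ
  have h3 := Finset.card_compl_add_card S
  have h4 : A.rank = familyRank ℝ A.col Finset.univ := by
    rw [Matrix.rank_eq_finrank_span_cols, familyRank, Finset.coe_univ, Set.image_univ]
  omega

lemma col_ne_zero {α β : Type*} [Fintype α] [Fintype β] {A : Matrix α β ℝ}
    (h : 1 ≤ kRank A) (r : β) : A.col r ≠ 0 := by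
  intro h0
  have h1 := min_kRank_le_familyRank A {r}
  have h2 : familyRank ℝ A.col {r} = 0 := by simp [familyRank, h0]
  rw [Finset.card_singleton] at h1
  omega

lemma cpdTensor_eq_sum_outer₃ {I J K R : ℕ} (A : Matrix (Fin I) (Fin R) ℝ)
    (B : Matrix (Fin J) (Fin R) ℝ) (C : Matrix (Fin K) (Fin R) ℝ) :
    cpdTensor A B C = ∑ r, outer₃ (A.col r) (B.col r) (C.col r) := by
  ext i j k
  simp [cpdTensor, Finset.sum_apply, outer₃_apply]

/-- Every decomposition with at most `R` terms has the same rank-1 terms as `[A, B, C]_R`. -/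
lemma map_outer₃_col_eq {I J K R n : ℕ} {A : Matrix (Fin I) (Fin R) ℝ}
    {B : Matrix (Fin J) (Fin R) ℝ} {C : Matrix (Fin K) (Fin R) ℝ}
    (h1 : 2 * R + 2 ≤ kRank A + B.rank + C.rank)
    (h2 : R + 2 ≤ min (C.rank + kRank B) (kRank C + B.rank))
    (hne : ∀ r, outer₃ (A.col r) (B.col r) (C.col r) ≠ 0)
    {A' : Matrix (Fin I) (Fin n) ℝ} {B' : Matrix (Fin J) (Fin n) ℝ}
    {C' : Matrix (Fin K) (Fin n) ℝ} (hn : n ≤ R) (hT : cpdTensor A B C = cpdTensor A' B' C') :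
    (Finset.univ.val.map fun s => outer₃ (A'.col s) (B'.col s) (C'.col s)) =
      Finset.univ.val.map fun r => outer₃ (A.col r) (B.col r) (C.col r) := by
  have hl : (Finset.univ : Finset (Fin R ⊕ Fin n)).toLeft = Finset.univ := by ext; simp
  have hr : (Finset.univ : Finset (Fin R ⊕ Fin n)).toRight = Finset.univ := by ext; simp
  have := map_outer₃_eq_map_outer₃ A.col B.col C.col A'.col B'.col C'.col hne (fun S hS => ?_)
    Finset.univ (by simpa [hl, hr] using hn)
    (by rw [hl, hr, ← cpdTensor_eq_sum_outer₃, ← cpdTensor_eq_sum_outer₃, hT])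
  · rwa [hl, hr] at this
  · have a1 := min_kRank_le_familyRank A S
    have b1 := min_kRank_le_familyRank B S
    have c1 := min_kRank_le_familyRank C S
    have b2 := rank_add_card_le_familyRank B S
    have c2 := rank_add_card_le_familyRank C S
    rw [Fintype.card_fin] at b2 c2
    omega

end FactorMatrices


/-- If `k_A + r_B + r_C ≥ 2R + 2` and
`min (r_C + k_B) (k_C + r_B) ≥ R + 2`, then the rank of `T = [A,B,C]_R` equals `R` and the
CPD of `T` is unique. -/
theorem stmt1 {I J K R : ℕ} (A : Matrix (Fin I) (Fin R) ℝ) (B : Matrix (Fin J) (Fin R) ℝ)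
    (C : Matrix (Fin K) (Fin R) ℝ)
    (h1 : 2 * R + 2 ≤ kRank A + B.rank + C.rank)
    (h2 : R + 2 ≤ min (C.rank + kRank B) (kRank C + B.rank)) :
    tensorRank (cpdTensor A B C) = R ∧ cpdUnique R (cpdTensor A B C) := by
  have hB : B.rank ≤ R := B.rank_le_width
  have hC : C.rank ≤ R := C.rank_le_width
  have hne (r : Fin R) : outer₃ (A.col r) (B.col r) (C.col r) ≠ 0 := by
    obtain ⟨i, hi⟩ := Function.ne_iff.1 (col_ne_zero (A := A) (by omega) r)
    obtain ⟨j, hj⟩ := Function.ne_iff.1 (col_ne_zero (A := B) (by omega) r)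
    obtain ⟨k, hk⟩ := Function.ne_iff.1 (col_ne_zero (A := C) (by omega) r)
    intro h0
    have := congrFun (congrFun (congrFun h0 i) j) k
    rw [outer₃_apply] at this
    exact mul_ne_zero (mul_ne_zero hi hj) hk this
  refine ⟨le_antisymm (Nat.sInf_le ⟨A, B, C, rfl⟩) ?_, ?_⟩
  · refine le_csInf ⟨R, A, B, C, rfl⟩ ?_
    rintro n ⟨A', B', C', hT⟩
    by_contra! hn
    have := congrArg Multiset.card (map_outer₃_col_eq h1 h2 hne hn.le hT)
    simp only [Multiset.card_map, Finset.card_val, Finset.card_univ, Fintype.card_fin] at this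
    omega
  · intro A₁ A₂ B₁ B₂ C₁ C₂ hT₁ hT₂
    have hm₁ := map_outer₃_col_eq h1 h2 hne le_rfl hT₁
    have hm₂ := map_outer₃_col_eq h1 h2 hne le_rfl hT₂
    obtain ⟨τ, hτ⟩ := exists_equiv_of_map_univ_eq hm₁
    obtain ⟨σ, hσ⟩ := exists_equiv_of_map_univ_eq (hm₂.trans hm₁.symm)
    choose la lb lc hl ha hb hc using fun r =>
      exists_scaling_of_outer₃_eq (hτ (σ r) ▸ hne (τ (σ r))) (hσ r).symm
    exact ⟨σ, la, lb, lc, hl, fun i r => ha r i, fun j r => hb r j, fun k r => hc r k⟩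
end
end

section
/- Let T = [A,B,C]_R be an I×J×K real tensor and set m := R − r_C + 2. Suppose that max(min(k_A, k_B − 1), min(k_A − 1, k_B)) + k_C ≥ R + 1 and that the Khatri–Rao product of compound matrices C_m(A) ⊙ C_m(B) has full column rank. Then the rank of T equals R and the CPD of T is unique. -/
open scoped BigOperators

noncomputable section

/-- The `m`-th compound matrix: the matrix of all `m × m` minors, with rows indexed by
`m`-element subsets of the rows and columns indexed by `m`-element subsets of the columns
(a subset of size `m` is enumerated in increasing order). -/
def compound {α : Type*} [CommRing α] {I J : ℕ} (m : ℕ) (A : Matrix (Fin I) (Fin J) α) :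
    Matrix {s : Finset (Fin I) // s.card = m} {t : Finset (Fin J) // t.card = m} α :=
  Matrix.of fun s t => Matrix.det (Matrix.of fun a b : Fin m =>
    A (s.1.orderIsoOfFin s.2 a : Fin I) (t.1.orderIsoOfFin t.2 b : Fin J))

/-- The Khatri–Rao (column-wise Kronecker) product of two matrices. -/
def khatriRao {α β γ : Type*} (A : Matrix α γ ℝ) (B : Matrix β γ ℝ) : Matrix (α × β) γ ℝ :=
  Matrix.of fun p r => A p.1 r * B p.2 r

open Matrix in
/-- The Cauchy–Binet formula. -/
theorem Matrix.det_mul_eq_sum_minors {α : Type*} [CommRing α] {m n : ℕ}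
    (X : Matrix (Fin m) (Fin n) α) (Y : Matrix (Fin n) (Fin m) α) :
    (X * Y).det = ∑ t : {t : Finset (Fin n) // t.card = m},
      (X.submatrix id fun a => (t.1.orderIsoOfFin t.2 a : Fin n)).det *
        (Y.submatrix (fun a => (t.1.orderIsoOfFin t.2 a : Fin n)) id).det := by
  have expand : (X * Y).det =
      ∑ f : Fin m → Fin n, (∏ i, X i (f i)) * (Y.submatrix f id).det := by
    have hrow : (X * Y) = fun i => ∑ k, X i k • Y k := by
      ext i j
      simp [Matrix.mul_apply]
    rw [hrow]
    refine (MultilinearMap.map_sum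
      (detRowAlternating : (Fin m → α) [⋀^Fin m]→ₗ[α] α).toMultilinearMap fun i k => X i k • Y k).trans ?_
    refine Finset.sum_congr rfl fun f _ => ?_
    exact MultilinearMap.map_smul_univ _ (fun i => X i (f i)) fun i => Y (f i)
  rw [expand]
  have hinner (t : {t : Finset (Fin n) // t.card = m}) :
      (X.submatrix id fun a => (t.1.orderIsoOfFin t.2 a : Fin n)).det *
        (Y.submatrix (fun a => (t.1.orderIsoOfFin t.2 a : Fin n)) id).det =
      ∑ σ : Equiv.Perm (Fin m), (∏ i, X i (t.1.orderIsoOfFin t.2 (σ i))) *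
        (Y.submatrix (fun a => (t.1.orderIsoOfFin t.2 (σ a) : Fin n)) id).det := by
    rw [← det_transpose (X.submatrix _ _), det_apply', Finset.sum_mul]
    refine Finset.sum_congr rfl fun σ _ => ?_
    have hperm : (Y.submatrix (fun a => (t.1.orderIsoOfFin t.2 (σ a) : Fin n)) id).det =
        Equiv.Perm.sign σ * (Y.submatrix (fun a => (t.1.orderIsoOfFin t.2 a : Fin n)) id).det :=
      det_permute σ (Y.submatrix (fun a => (t.1.orderIsoOfFin t.2 a : Fin n)) id)
    rw [hperm]
    simp only [transpose_apply, submatrix_apply, id]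
    ring
  simp_rw [hinner]
  rw [← Fintype.sum_prod_type']
  symm
  refine Fintype.sum_of_injective
    (fun p : {t : Finset (Fin n) // t.card = m} × Equiv.Perm (Fin m) =>
      fun i => (p.1.1.orderIsoOfFin p.1.2 (p.2 i) : Fin n)) ?_ _ _ ?_ fun _ => rfl
  · rintro ⟨⟨s, hs⟩, σ⟩ ⟨⟨t, ht⟩, τ⟩ h
    have image_eq (u : Finset (Fin n)) (hu : u.card = m) (ρ : Equiv.Perm (Fin m)) :
        Set.range (fun i => (u.orderIsoOfFin hu (ρ i) : Fin n)) = u := by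
      ext x
      constructor
      · rintro ⟨i, rfl⟩
        exact (u.orderIsoOfFin hu (ρ i)).2
      · intro hx
        exact ⟨ρ.symm ((u.orderIsoOfFin hu).symm ⟨x, hx⟩), by simp⟩
    have hst : s = t := by
      rw [← Finset.coe_inj, ← image_eq s hs σ, ← image_eq t ht τ]
      exact congrArg Set.range h
    subst hst
    congr 1
    refine Equiv.ext fun i => ?_
    simpa using congrFun h i
  · intro f hf
    by_cases hinj : Function.Injective f
    · refine absurd ?_ hf
      have hcard : (Finset.univ.image f).card = m := by
        rw [Finset.card_image_of_injective _ hinj, Finset.card_fin]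
      let g : Fin m → Fin m := fun i =>
        ((Finset.univ.image f).orderIsoOfFin hcard).symm ⟨f i, by simp⟩
      have hg : Function.Injective g := fun i j hij => hinj <| by
        simpa [g] using hij
      refine ⟨⟨⟨_, hcard⟩, Equiv.ofBijective g (Finite.injective_iff_bijective.1 hg)⟩, ?_⟩
      ext i
      simp [g]
    · obtain ⟨i, j, hij, hne⟩ : ∃ i j, f i = f j ∧ i ≠ j := by
        simpa [Function.Injective] using hinj
      rw [det_zero_of_row_eq hne (by ext; simp [hij]), mul_zero]

open Matrix in
/-- A matrix whose rank is its number of columns acts injectively. -/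
theorem Matrix.eq_zero_of_mulVec_eq_zero_of_rank_eq_card {α β : Type*} [Fintype α] [Fintype β]
    {M : Matrix α β ℝ} (hM : M.rank = Fintype.card β) {w : β → ℝ} (hw : M *ᵥ w = 0) : w = 0 := by
  have h := LinearMap.finrank_range_add_finrank_ker M.mulVecLin
  rw [← Matrix.rank, hM, Module.finrank_pi] at h
  have hker : LinearMap.ker M.mulVecLin = ⊥ := Submodule.finrank_eq_zero.1 (by omega)
  exact LinearMap.ker_eq_bot'.1 hker w hw

open Matrix in
theorem det_submatrix_eq_zero_of_rank_lt {α β : Type*} [Fintype α] [Fintype β] {m : ℕ}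
    {M : Matrix α β ℝ} (hM : M.rank < m) (f : Fin m → α) (g : Fin m → β) :
    (M.submatrix f g).det = 0 := by
  by_contra hne
  have h := rank_of_det_ne_zero hne
  have h' := rank_submatrix_le M f g
  rw [Fintype.card_fin] at h
  omega

open Matrix in
/-- If `C_m(A) ⊙ C_m(B)` has full column rank, a matrix `A diag(d) Bᵀ` of rank below `m` comes
from a vector `d` with fewer than `m` nonzero entries. -/
theorem card_support_lt_of_rank_lt {I J R m : ℕ} {A : Matrix (Fin I) (Fin R) ℝ}
    {B : Matrix (Fin J) (Fin R) ℝ}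
    (hAB : (khatriRao (compound m A) (compound m B)).rank = Nat.choose R m) {d : Fin R → ℝ}
    (hd : (A * diagonal d * Bᵀ).rank < m) : (Finset.univ.filter fun r => d r ≠ 0).card < m := by
  have hw : (fun t : {t : Finset (Fin R) // t.card = m} => ∏ r ∈ t.1, d r) = 0 := by
    refine eq_zero_of_mulVec_eq_zero_of_rank_eq_card
      (M := khatriRao (compound m A) (compound m B)) (by simp [hAB]) ?_
    ext ⟨S, T⟩
    have h0 := det_submatrix_eq_zero_of_rank_lt hd (fun a => (S.1.orderIsoOfFin S.2 a : Fin I))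
      (fun a => (T.1.orderIsoOfFin T.2 a : Fin J))
    rw [← submatrix_mul_equiv _ _ _ (Equiv.refl (Fin R)) _, det_mul_eq_sum_minors] at h0
    rw [Pi.zero_apply, ← h0, mulVec, dotProduct]
    refine Finset.sum_congr rfl fun t _ => ?_
    have hprod : ∏ r ∈ t.1, d r = ∏ a : Fin m, d (t.1.orderIsoOfFin t.2 a) := by
      rw [← Finset.prod_coe_sort t.1 d]
      exact (Equiv.prod_comp (t.1.orderIsoOfFin t.2).toEquiv fun r => d r.1).symm
    have hA : (((A * diagonal d).submatrix (fun a => (S.1.orderIsoOfFin S.2 a : Fin I))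
        (Equiv.refl (Fin R))).submatrix id fun a => (t.1.orderIsoOfFin t.2 a : Fin R)).det =
        (∏ r ∈ t.1, d r) * compound m A S t := by
      rw [hprod, compound, of_apply, ← det_mul_row]
      congr 1
      ext a b
      simp [mul_diagonal, mul_comm]
    have hB : ((Bᵀ.submatrix (Equiv.refl (Fin R))
        (fun a => (T.1.orderIsoOfFin T.2 a : Fin J))).submatrix
          (fun a => (t.1.orderIsoOfFin t.2 a : Fin R)) id).det = compound m B T t := by
      rw [compound, of_apply, ← det_transpose]
      rfl
    rw [hA, hB]
    simp only [khatriRao, of_apply]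
    ring
  by_contra! hcard
  obtain ⟨t, ht, htm⟩ := Finset.exists_subset_card_eq hcard
  have h0 := congrFun hw ⟨t, htm⟩
  obtain ⟨r, hr, hr0⟩ := Finset.prod_eq_zero_iff.1 h0
  exact (Finset.mem_filter.1 (ht hr)).2 hr0

open Matrix in
theorem rank_mul_diagonal_mul_le {α β ι : Type*} [Fintype α] [Fintype β] [Fintype ι]
    [DecidableEq ι] (A : Matrix α ι ℝ) (B : Matrix ι β ℝ) (d : ι → ℝ) :
    (A * diagonal d * B).rank ≤ (Finset.univ.filter fun r => d r ≠ 0).card := by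
  classical
  calc (A * diagonal d * B).rank ≤ (A * diagonal d).rank := rank_mul_le_left _ _
    _ ≤ (diagonal d).rank := rank_mul_le_right _ _
    _ = _ := by rw [rank_diagonal, Fintype.card_subtype]

theorem Matrix.rank_add_le {α β : Type*} [Fintype α] [Fintype β] (M N : Matrix α β ℝ) :
    (M + N).rank ≤ M.rank + N.rank := by
  rw [Matrix.rank, Matrix.mulVecLin_add]
  exact (Submodule.finrank_mono (LinearMap.range_add_le _ _)).trans
    (Submodule.finrank_add_le_finrank_add_finrank _ _)

open Matrix in
/-- If `C_m(A) ⊙ C_m(B)` has full column rank, a matrix `A diag(d) Bᵀ` of rank below `m` has rank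
the number of nonzero entries of `d`. -/
theorem card_support_le_rank {I J R m : ℕ} (hmR : m ≤ R) {A : Matrix (Fin I) (Fin R) ℝ}
    {B : Matrix (Fin J) (Fin R) ℝ}
    (hAB : (khatriRao (compound m A) (compound m B)).rank = Nat.choose R m) {d : Fin R → ℝ}
    (hd : (A * diagonal d * Bᵀ).rank < m) :
    (Finset.univ.filter fun r => d r ≠ 0).card ≤ (A * diagonal d * Bᵀ).rank := by
  by_contra! hlt
  have hlt_m := card_support_lt_of_rank_lt hAB hd
  obtain ⟨t, hst, htm⟩ := Finset.exists_superset_card_eq hlt_m.le (by simpa using hmR)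
  let e : Fin R → ℝ := fun r => if r ∈ t \ Finset.univ.filter (fun r => d r ≠ 0) then 1 else 0
  have he : (Finset.univ.filter fun r => e r ≠ 0).card =
      m - (Finset.univ.filter fun r => d r ≠ 0).card := by
    rw [← htm, ← Finset.card_sdiff_of_subset hst]
    congr 1
    ext r
    simp [e]
  have hsupp : (Finset.univ.filter fun r => (d + e) r ≠ 0) = t := by
    ext r
    by_cases hr : d r = 0
    · simp [e, hr]
    · have : r ∈ t := hst (by simp [hr])
      simp [e, hr, this]
  have hrank : (A * diagonal (d + e) * Bᵀ).rank < m := by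
    have hsum : A * diagonal (d + e) * Bᵀ = A * diagonal d * Bᵀ + A * diagonal e * Bᵀ := by
      rw [← Matrix.add_mul, ← Matrix.mul_add, diagonal_add]
      rfl
    have h1 := rank_add_le (A * diagonal d * Bᵀ) (A * diagonal e * Bᵀ)
    have h2 := rank_mul_diagonal_mul_le A Bᵀ e
    rw [hsum]
    omega
  have := card_support_lt_of_rank_lt hAB hrank
  rw [hsupp] at this
  omega

/-- If the hyperplanes containing many vectors of a family `c'` contain at least as many vectors
of a family `c`, then so do all subspaces spanned by vectors of `c'`. -/
theorem card_mem_span_le {V ι : Type*} [AddCommGroup V] [Module ℝ V] [FiniteDimensional ℝ V]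
    [Fintype ι] [DecidableEq ι] {c c' : ι → V}
    (hspan : Submodule.span ℝ (Set.range c) ≤ Submodule.span ℝ (Set.range c'))
    (H : ∀ φ : Module.Dual ℝ V,
      Module.finrank ℝ (Submodule.span ℝ (Set.range c')) ≤
          (Finset.univ.filter fun i => φ (c' i) = 0).card + 1 →
        (Finset.univ.filter fun i => φ (c' i) = 0).card ≤
          (Finset.univ.filter fun i => φ (c i) = 0).card) :
    ∀ (n : ℕ) (s : Finset ι),
      Module.finrank ℝ (Submodule.span ℝ (Set.range c')) -
        Module.finrank ℝ (Submodule.span ℝ (c' '' s)) = n →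
      (Set.ncard {i | c' i ∈ Submodule.span ℝ (c' '' s)}) ≤
        Set.ncard {i | c i ∈ Submodule.span ℝ (c' '' s)} := by
  classical
  intro n
  induction n using Nat.strong_induction_on with
  | _ n ih =>
  intro s hs
  set S := Submodule.span ℝ (Set.range c') with hS
  set U := Submodule.span ℝ (c' '' s) with hU
  have hUS : U ≤ S := Submodule.span_mono (Set.image_subset_range _ _)
  have hc'S (i) : c' i ∈ S := Submodule.subset_span ⟨i, rfl⟩
  have hcS (i) : c i ∈ S := hspan (Submodule.subset_span ⟨i, rfl⟩)
  have hrank := Submodule.finrank_mono hUS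
  rcases Nat.lt_or_ge n 2 with hn | hn
  · -- the subspace is cut out by a single functional
    obtain ⟨φ, hφ⟩ : ∃ φ : Module.Dual ℝ V, ∀ v ∈ S, φ v = 0 ↔ v ∈ U := by
      by_cases hSU : S ≤ U
      · exact ⟨0, fun v hv => by simpa using hSU hv⟩
      · obtain ⟨v₀, hv₀S, hv₀U⟩ := Set.not_subset.1 hSU
        obtain ⟨φ, hφv, hφU⟩ := Submodule.exists_le_ker_of_notMem hv₀U
        have hle : U ≤ S ⊓ LinearMap.ker φ := le_inf hUS hφU
        have hlt : S ⊓ LinearMap.ker φ < S := lt_of_le_of_ne inf_le_left fun h => hφv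
          (by simpa using (h.symm.le hv₀S).2)
        have heq := Submodule.eq_of_le_of_finrank_le hle (by
          have := Submodule.finrank_lt_finrank_of_lt hlt
          omega)
        refine ⟨φ, fun v hv => ?_⟩
        rw [heq]
        simp [hv]
    have e1 : {i | c' i ∈ U} = ↑(Finset.univ.filter fun i => φ (c' i) = 0) := by
      ext i; simp [hφ _ (hc'S i)]
    have e2 : {i | c i ∈ U} = ↑(Finset.univ.filter fun i => φ (c i) = 0) := by
      ext i; simp [hφ _ (hcS i)]
    rw [e1, e2, Set.ncard_coe_finset, Set.ncard_coe_finset]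
    refine H φ ?_
    have hle : Module.finrank ℝ U ≤ (Finset.univ.filter fun i => φ (c' i) = 0).card := by
      have hsub : U = Submodule.span ℝ
          (((Finset.univ.filter fun i => φ (c' i) = 0).image c' : Finset V) : Set V) := by
        refine le_antisymm (Submodule.span_mono ?_) (Submodule.span_le.2 ?_)
        · rintro _ ⟨i, hi, rfl⟩
          simpa using ⟨i, (hφ _ (hc'S i)).2 (Submodule.subset_span ⟨i, hi, rfl⟩), rfl⟩
        · intro v hv
          obtain ⟨i, hi, rfl⟩ : ∃ i, φ (c' i) = 0 ∧ c' i = v := by simpa using hv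
          exact (hφ _ (hc'S i)).1 hi
      rw [hsub]
      exact (finrank_span_finset_le_card _).trans Finset.card_image_le
    omega
  · -- count over the subspaces spanned by `U` and one more vector
    let W : V → Submodule ℝ V := fun v => U ⊔ Submodule.span ℝ {v}
    have hW {v w : V} (hv : v ∉ U) (hvw : v ∈ W w) : W v = W w := by
      obtain ⟨u, hu, a, rfl⟩ : ∃ u ∈ U, ∃ a : ℝ, u + a • w = v := by
        obtain ⟨u, hu, z, hz, rfl⟩ := Submodule.mem_sup.1 hvw
        obtain ⟨a, rfl⟩ := Submodule.mem_span_singleton.1 hz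
        exact ⟨u, hu, a, rfl⟩
      have ha : a ≠ 0 := by
        rintro rfl
        exact hv (by simpa using hu)
      refine le_antisymm (sup_le le_sup_left ?_) (sup_le le_sup_left ?_)
      · rwa [Submodule.span_singleton_le_iff_mem]
      · rw [Submodule.span_singleton_le_iff_mem]
        have hmem : a⁻¹ • ((u + a • w) - u) ∈ W (u + a • w) :=
          Submodule.smul_mem _ _ (Submodule.sub_mem _
            (Submodule.mem_sup_right (Submodule.mem_span_singleton_self _))
            (Submodule.mem_sup_left hu))
        simpa [smul_smul, ha] using hmem
    have hself (v) : v ∈ W v := Submodule.mem_sup_right (Submodule.mem_span_singleton_self _)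
    have hspanW (i) : W (c' i) = Submodule.span ℝ (c' '' (insert i s : Finset ι)) := by
      rw [Finset.coe_insert, Set.image_insert_eq, Submodule.span_insert, sup_comm]
    have hWrank (i) : Module.finrank ℝ (W (c' i)) ≤ Module.finrank ℝ U + 1 :=
      (Submodule.finrank_add_le_finrank_add_finrank _ _).trans
        (Nat.add_le_add_left (by
          simpa using finrank_span_le_card ({c' i} : Set V)) _)
    let N' := Finset.univ.filter fun i => c' i ∉ U
    let N := Finset.univ.filter fun i => c i ∉ U
    let F := N'.image fun i => W (c' i)
    have hF2 : 1 < F.card := by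
      have exists_notMem (X : Submodule ℝ V) (hX : Module.finrank ℝ X < Module.finrank ℝ S) :
          ∃ i, c' i ∉ X := by
        by_contra! h
        exact absurd (Submodule.finrank_mono (show S ≤ X from
          Submodule.span_le.2 (by rintro _ ⟨i, rfl⟩; exact h i))) (by omega)
      obtain ⟨i, hi⟩ := exists_notMem U (by omega)
      obtain ⟨j, hj⟩ := exists_notMem (W (c' i)) (by have := hWrank i; omega)
      refine Finset.one_lt_card.2 ⟨W (c' i), Finset.mem_image_of_mem _ (by simpa [N'] using hi),
        W (c' j), Finset.mem_image_of_mem _ ?_, fun h => hj (h ▸ hself _)⟩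
      simpa [N'] using fun h => hj (Submodule.mem_sup_left h)
    have count' : N'.card = ∑ X ∈ F, (N'.filter fun i => W (c' i) = X).card :=
      Finset.card_eq_sum_card_fiberwise fun i hi => Finset.mem_image_of_mem _ hi
    have count : ∑ X ∈ F, (N.filter fun i => W (c i) = X).card ≤ N.card := by
      rw [← Finset.card_biUnion]
      · exact Finset.card_le_card (Finset.biUnion_subset.2 fun _ _ => Finset.filter_subset _ _)
      · intro X _ Y _ hXY
        exact Finset.disjoint_left.2 fun i hi hj => hXY
          ((Finset.mem_filter.1 hi).2.symm.trans (Finset.mem_filter.1 hj).2)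
    have split (b : ι → V) (X : Submodule ℝ V) (hX : X ∈ F) :
        Set.ncard {i | b i ∈ X} = Set.ncard {i | b i ∈ U} +
          ((Finset.univ.filter fun i => b i ∉ U).filter fun i => W (b i) = X).card := by
      obtain ⟨k, -, rfl⟩ := Finset.mem_image.1 hX
      rw [← Set.ncard_coe_finset, ← Set.ncard_union_eq]
      · congr 1
        ext i
        by_cases hi : b i ∈ U
        · have : b i ∈ W (c' k) := Submodule.mem_sup_left hi
          simp [hi, this]
        · have : b i ∈ W (c' k) ↔ W (b i) = W (c' k) := ⟨hW hi, fun h => h ▸ hself _⟩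
          simp [hi, this]
      · refine Set.disjoint_left.2 fun i hi hj => ?_
        simp only [Finset.coe_filter, Finset.mem_filter, Set.mem_ofPred_eq] at hi hj
        exact hj.1.2 hi
    have total (b : ι → V) : Set.ncard {i | b i ∈ U} +
        (Finset.univ.filter fun i => b i ∉ U).card = Fintype.card ι := by
      have : {i | b i ∈ U} = ↑(Finset.univ.filter fun i => b i ∈ U) := by ext; simp
      rw [this, Set.ncard_coe_finset, Finset.card_filter_add_card_filter_not, Finset.card_univ]
    have hle : ∑ X ∈ F, (Set.ncard {i | c' i ∈ U} + (N'.filter fun i => W (c' i) = X).card) ≤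
        ∑ X ∈ F, (Set.ncard {i | c i ∈ U} + (N.filter fun i => W (c i) = X).card) := by
      refine Finset.sum_le_sum fun X hX => ?_
      rw [← split c' X hX, ← split c X hX]
      obtain ⟨k, hk, rfl⟩ := Finset.mem_image.1 hX
      have hlt : U < W (c' k) := lt_of_le_of_ne le_sup_left fun h =>
        (Finset.mem_filter.1 hk).2 (h ▸ hself _)
      have h1 := Submodule.finrank_lt_finrank_of_lt hlt
      have h2 := hspanW k
      rw [h2] at h1 ⊢
      refine ih _ ?_ (insert k s) rfl
      omega
    simp only [Finset.sum_add_distrib, Finset.sum_const, smul_eq_mul] at hle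
    have t1 : _ + N'.card = _ := total c'
    have t2 : _ + N.card = _ := total c
    obtain ⟨f, hf⟩ : ∃ f, F.card = f + 2 := ⟨F.card - 2, by omega⟩
    rw [hf] at hle
    nlinarith

/-- Kruskal's permutation lemma. -/
theorem exists_perm_smul_of_card_le {V ι : Type*} [AddCommGroup V] [Module ℝ V]
    [FiniteDimensional ℝ V] [Fintype ι] {c c' : ι → V} (hc0 : ∀ i, c i ≠ 0)
    (hc : ∀ i j, c i ∈ Submodule.span ℝ {c j} → i = j)
    (H : ∀ φ : Module.Dual ℝ V,
      Module.finrank ℝ (Submodule.span ℝ (Set.range c)) ≤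
          (Finset.univ.filter fun i => φ (c' i) = 0).card + 1 →
        (Finset.univ.filter fun i => φ (c' i) = 0).card ≤
          (Finset.univ.filter fun i => φ (c i) = 0).card) :
    ∃ (σ : Equiv.Perm ι) (l : ι → ℝ), ∀ i, l i ≠ 0 ∧ c' i = l i • c (σ i) := by
  classical
  have hspan : Submodule.span ℝ (Set.range c) ≤ Submodule.span ℝ (Set.range c') := by
    refine Submodule.span_le.2 ?_
    rintro _ ⟨j, rfl⟩
    by_contra hj
    obtain ⟨φ, hφ, hker⟩ := Submodule.exists_le_ker_of_notMem hj
    have hall : (Finset.univ.filter fun i => φ (c' i) = 0) = Finset.univ :=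
      Finset.filter_true_of_mem fun i _ => hker (Submodule.subset_span ⟨i, rfl⟩)
    have h := H φ (by
      rw [hall, Finset.card_univ]
      exact (finrank_range_le_card c).trans (Nat.le_succ _))
    rw [hall] at h
    have huniv := (Finset.card_eq_iff_eq_univ _).1
      (le_antisymm (Finset.card_le_univ _) (Finset.card_univ (α := ι) ▸ h))
    exact hφ ((Finset.filter_eq_self.1 huniv) j (Finset.mem_univ j))
  have key := fun s => card_mem_span_le hspan
    (fun φ hφ => H φ ((Submodule.finrank_mono hspan).trans hφ)) _ s rfl
  have hline (i) : Set.ncard {j | c' j ∈ Submodule.span ℝ {c' i}} ≤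
      Set.ncard {j | c j ∈ Submodule.span ℝ {c' i}} := by
    simpa using key {i}
  have hexists (i) : ∃ j, ∃ a : ℝ, a ≠ 0 ∧ c' i = a • c j := by
    have hmem : i ∈ {j | c' j ∈ Submodule.span ℝ {c' i}} := Submodule.mem_span_singleton_self _
    have := ((Set.ncard_pos (Set.toFinite _)).2 ⟨i, hmem⟩).trans_le (hline i)
    obtain ⟨j, hj⟩ := (Set.ncard_pos (Set.toFinite _)).1 this
    obtain ⟨a, ha⟩ := Submodule.mem_span_singleton.1 hj
    have ha0 : a ≠ 0 := by
      rintro rfl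
      exact hc0 j (by simpa using ha.symm)
    exact ⟨j, a⁻¹, inv_ne_zero ha0, by rw [← ha, smul_smul, inv_mul_cancel₀ ha0, one_smul]⟩
  choose σ l hl0 hl using hexists
  have hinj : Function.Injective σ := by
    intro i k hik
    have hone : Set.ncard {j | c j ∈ Submodule.span ℝ {c' i}} ≤ 1 := by
      refine (Set.ncard_le_one_iff (Set.toFinite _)).2 fun {a b} ha hb => ?_
      have hi : Submodule.span ℝ {c' i} = Submodule.span ℝ {c (σ i)} := by
        rw [hl i]
        exact Submodule.span_singleton_smul_eq (IsUnit.mk0 _ (hl0 i)) _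
      rw [Set.mem_ofPred_eq, hi] at ha hb
      rw [hc _ _ ha, hc _ _ hb]
    refine (Set.ncard_le_one_iff (Set.toFinite _)).1 ((hline i).trans hone)
      (Submodule.mem_span_singleton_self _) ?_
    refine Submodule.mem_span_singleton.2 ⟨l k * (l i)⁻¹, ?_⟩
    rw [hl k, hl i, ← hik, smul_smul, mul_assoc, inv_mul_cancel₀ (hl0 i), mul_one]
  exact ⟨Equiv.ofBijective σ (Finite.injective_iff_bijective.1 hinj), l, fun i =>
    ⟨hl0 i, hl i⟩⟩

theorem kRank_le_card {α β : Type*} [Fintype α] [Fintype β] (A : Matrix α β ℝ) :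
    kRank A ≤ Fintype.card β :=
  csSup_le' fun _ hk => hk.1

theorem linearIndepOn_of_card_le_kRank {α β : Type*} [Fintype α] [Fintype β] {A : Matrix α β ℝ}
    {s : Finset β} (hs : s.card ≤ kRank A) : LinearIndepOn ℝ A.col (s : Set β) := by
  have hmem := Nat.sSup_mem (s := {k | k ≤ Fintype.card β ∧ ∀ s : Finset β, s.card = k →
      LinearIndependent ℝ fun j : s => fun i : α => A i j.1})
    ⟨0, Nat.zero_le _, fun t ht => by
      have : IsEmpty t := by rw [Finset.card_eq_zero.1 ht]; infer_instance
      exact linearIndependent_empty_type⟩ ⟨Fintype.card β, fun _ hk => hk.1⟩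
  obtain ⟨t, hst, ht⟩ := Finset.exists_superset_card_eq hs (kRank_le_card A)
  have ht' : LinearIndepOn ℝ A.col (t : Set β) := hmem.2 t ht
  exact ht'.mono (by exact_mod_cast hst)

theorem LinearIndepOn.exists_dual {V ι : Type*} [AddCommGroup V] [Module ℝ V] {v : ι → V}
    {s : Set ι} (h : LinearIndepOn ℝ v s) {i : ι} (hi : i ∈ s) :
    ∃ φ : Module.Dual ℝ V, φ (v i) ≠ 0 ∧ ∀ j ∈ s, j ≠ i → φ (v j) = 0 := by
  obtain ⟨φ, hφ, hker⟩ := Submodule.exists_le_ker_of_notMem (h.notMem_span hi)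
  exact ⟨φ, hφ, fun j hj hji => hker (Submodule.subset_span ⟨j, ⟨hj, hji⟩, rfl⟩)⟩

/-- If two bilinear expressions with the same weights `d` agree and the weights are supported
where the vectors of the first one are independent, the second one uses the same span. -/
theorem mem_span_of_sum_smul_eq {V W ι : Type*} [AddCommGroup V] [Module ℝ V] [AddCommGroup W]
    [Module ℝ W] [FiniteDimensional ℝ W] [Fintype ι] {a a' : ι → V} {b b' : ι → W}
    {d : ι → ℝ} (h : ∀ y : Module.Dual ℝ W,
      ∑ r, (d r * y (b r)) • a r = ∑ r, (d r * y (b' r)) • a' r)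
    {s : Finset ι} (hd : ∀ r ∉ s, d r = 0) (ha : LinearIndepOn ℝ a (s : Set ι))
    (hb : LinearIndepOn ℝ b (s : Set ι)) {r : ι} (hr : d r ≠ 0) :
    b' r ∈ Submodule.span ℝ (b '' s) ∧ b' r ≠ 0 := by
  classical
  let t := Finset.univ.filter fun r => d r ≠ 0
  have hts : t ⊆ s := fun i hi => by
    by_contra hi'
    exact (Finset.mem_filter.1 hi).2 (hd i hi')
  have htb : LinearIndepOn ℝ b (t : Set ι) := hb.mono (by exact_mod_cast hts)
  have hle : Submodule.span ℝ (b '' t) ≤ Submodule.span ℝ (b' '' t) := by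
    refine Submodule.span_le.2 ?_
    rintro _ ⟨i, hi, rfl⟩
    by_contra hi'
    obtain ⟨y, hy, hker⟩ := Submodule.exists_le_ker_of_notMem hi'
    have hzero : ∑ r ∈ s, (d r * y (b r)) • a r = 0 := by
      rw [Finset.sum_subset (Finset.subset_univ s)
        fun r _ hrs => by rw [hd r hrs, zero_mul, zero_smul], h y]
      refine Finset.sum_eq_zero fun r _ => ?_
      by_cases hr : d r = 0
      · rw [hr, zero_mul, zero_smul]
      · have : y (b' r) = 0 := hker (Submodule.subset_span ⟨r, by simpa [t] using hr, rfl⟩)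
        rw [this, mul_zero, zero_smul]
    have hi0 := linearIndepOn_finset_iff.1 ha _ hzero i (hts hi)
    exact (mul_ne_zero (Finset.mem_filter.1 hi).2 hy) hi0
  have hrank : Module.finrank ℝ (Submodule.span ℝ (b '' t)) = t.card := by
    have := finrank_span_eq_card htb
    rw [← Set.image_eq_range] at this
    simpa using this
  have image_coe (v : ι → W) (u : Finset ι) : v '' u = ((u.image v : Finset W) : Set W) := by simp
  have hcard (u : Finset ι) : Module.finrank ℝ (Submodule.span ℝ (b' '' u)) ≤ u.card := by
    rw [image_coe]
    exact (finrank_span_finset_le_card _).trans Finset.card_image_le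
  have heq := Submodule.eq_of_le_of_finrank_le hle ((hcard t).trans hrank.ge)
  have hrt : r ∈ t := by simpa [t] using hr
  refine ⟨?_, fun h0 => ?_⟩
  · refine Submodule.span_mono (Set.image_mono (by exact_mod_cast hts)) ?_
    rw [heq]
    exact Submodule.subset_span ⟨r, hrt, rfl⟩
  · have herase : Submodule.span ℝ (b' '' t) ≤ Submodule.span ℝ (b' '' (t.erase r : Finset ι)) := by
      refine Submodule.span_le.2 ?_
      rintro _ ⟨i, hi, rfl⟩
      by_cases hir : i = r
      · rw [hir, h0]
        exact Submodule.zero_mem _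
      · exact Submodule.subset_span ⟨i, by simpa [hir] using hi, rfl⟩
    have h1 := (Submodule.finrank_mono herase).trans (hcard _)
    rw [← heq, hrank] at h1
    exact absurd (Finset.card_erase_lt_of_mem hrt) (by omega)

/-- A vector in the span of every `p`-subfamily containing `b r` is a multiple of `b r`, when the
subfamilies of size `p + 1` are independent. -/
theorem exists_smul_eq_of_forall_mem_span {W ι : Type*} [AddCommGroup W] [Module ℝ W] [Fintype ι]
    {b : ι → W} {p : ℕ} (hp : 1 ≤ p) (hpι : p < Fintype.card ι)
    (hb : ∀ s : Finset ι, s.card ≤ p + 1 → LinearIndepOn ℝ b (s : Set ι)) {r : ι} {w : W}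
    (hw : ∀ s : Finset ι, r ∈ s → s.card = p → w ∈ Submodule.span ℝ (b '' s)) :
    ∃ β : ℝ, w = β • b r := by
  classical
  obtain ⟨s, hrs, hs⟩ := Finset.exists_superset_card_eq (s := {r}) (by simpa using hp) hpι.le
  rw [Finset.singleton_subset_iff] at hrs
  obtain ⟨n, hn⟩ : ∃ n, n ∉ s := by
    by_contra! h
    rw [Finset.eq_univ_of_forall h, Finset.card_univ] at hs
    omega
  obtain ⟨g, hg⟩ := (Submodule.mem_span_image_finset_iff_exists_fun' ℝ).1 (hw s hrs hs)
  have hzero (j) (hj : j ∈ s) (hjr : j ≠ r) : g j = 0 := by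
    have hcard : (insert n s).card ≤ p + 1 := (Finset.card_insert_le _ _).trans (by omega)
    obtain ⟨y, hy, hy0⟩ := (hb _ hcard).exists_dual (i := j) (by simp [hj])
    have hyw : y w = 0 := by
      have hmem := hw (insert n (s.erase j)) (by simp [hrs, hjr.symm]) (by
        rw [Finset.card_insert_of_notMem (by simp [hn]), Finset.card_erase_of_mem hj]
        omega)
      refine (Submodule.span_le (p := LinearMap.ker y)).2 ?_ hmem
      rintro _ ⟨i, hi, rfl⟩
      have hij : i ≠ j := by
        rintro rfl
        have : i = n := by simpa using hi
        exact hn (this ▸ hj)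
      refine hy0 i ?_ hij
      simp only [Finset.coe_insert, Finset.coe_erase, Set.mem_insert_iff] at hi ⊢
      exact hi.imp_right fun h => h.1
    rw [← hg, map_sum, Finset.sum_eq_single_of_mem j hj] at hyw
    · simpa [hy] using hyw
    · intro i hi hij
      rw [map_smul, hy0 i (by simp [hi]) hij, smul_zero]
  refine ⟨g r, ?_⟩
  rw [← hg, Finset.sum_eq_single_of_mem r hrs fun j hj hjr => by rw [hzero j hj hjr, zero_smul]]

/-- Uniqueness of the first two factors when the third one is known. -/
theorem exists_smul_eq_of_sum_smul_eq {U V W ι : Type*} [AddCommGroup U] [Module ℝ U]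
    [AddCommGroup V] [Module ℝ V] [AddCommGroup W] [Module ℝ W] [FiniteDimensional ℝ W]
    [Fintype ι] {a a' : ι → V} {b b' : ι → W} {c : ι → U}
    (h : ∀ (φ : Module.Dual ℝ U) (y : Module.Dual ℝ W),
      ∑ r, (φ (c r) * y (b r)) • a r = ∑ r, (φ (c r) * y (b' r)) • a' r)
    {p q : ℕ} (hp : 1 ≤ p) (hq : 2 ≤ q) (hpq : p + q = Fintype.card ι + 1)
    (ha : ∀ s : Finset ι, s.card ≤ p → LinearIndepOn ℝ a (s : Set ι))
    (hb : ∀ s : Finset ι, s.card ≤ p + 1 → LinearIndepOn ℝ b (s : Set ι))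
    (hc : ∀ s : Finset ι, s.card ≤ q → LinearIndepOn ℝ c (s : Set ι)) (r : ι) :
    ∃ β : ℝ, β ≠ 0 ∧ b' r = β • b r ∧ a r = β • a' r := by
  classical
  have hdual (r : ι) (s : Finset ι) (hrs : r ∈ s) (hs : s.card = p) :
      ∃ φ : Module.Dual ℝ U, φ (c r) ≠ 0 ∧ ∀ i ∉ s, φ (c i) = 0 := by
    have hcard : (insert r sᶜ).card ≤ q :=
      (Finset.card_insert_le _ _).trans (by rw [Finset.card_compl]; omega)
    obtain ⟨φ, hφ, hφ0⟩ := (hc _ hcard).exists_dual (i := r) (by simp)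
    exact ⟨φ, hφ, fun i hi => hφ0 i (by simp [hi]) fun hir => hi (hir ▸ hrs)⟩
  have hspan (r : ι) (s : Finset ι) (hrs : r ∈ s) (hs : s.card = p) :
      b' r ∈ Submodule.span ℝ (b '' s) ∧ b' r ≠ 0 := by
    obtain ⟨φ, hφ, hφ0⟩ := hdual r s hrs hs
    exact mem_span_of_sum_smul_eq (h φ) hφ0 (ha s hs.le) (hb s (by omega)) hφ
  have hβ (r : ι) : ∃ β : ℝ, b' r = β • b r :=
    exists_smul_eq_of_forall_mem_span hp (by omega) hb fun s hrs hs => (hspan r s hrs hs).1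
  choose β hβ using hβ
  obtain ⟨s, hrs, hs⟩ := Finset.exists_superset_card_eq (s := {r}) (n := p) (by simpa using hp)
    (by omega)
  rw [Finset.singleton_subset_iff] at hrs
  refine ⟨β r, ?_, hβ r, ?_⟩
  · intro h0
    exact (hspan r s hrs hs).2 (by rw [hβ r, h0, zero_smul])
  · obtain ⟨φ, hφ, hφ0⟩ := hdual r s hrs hs
    obtain ⟨y, hy, hy0⟩ := (hb s (by omega)).exists_dual (i := r) (by exact_mod_cast hrs)
    have hother (i : ι) (hir : i ≠ r) : φ (c i) * y (b i) = 0 := by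
      by_cases hi : i ∈ s
      · rw [hy0 i hi hir, mul_zero]
      · rw [hφ0 i hi, zero_mul]
    have hry := h φ y
    rw [Finset.sum_eq_single r (fun i _ hir => by rw [hother i hir, zero_smul]) (by simp),
      Finset.sum_eq_single r (fun i _ hir => by
        rw [hβ i, map_smul, smul_eq_mul, mul_left_comm, hother i hir, mul_zero, zero_smul])
        (by simp), hβ r, map_smul, smul_eq_mul, mul_left_comm, mul_comm (β r),
      mul_smul _ (β r)] at hry
    exact smul_right_injective V (mul_ne_zero hφ hy) hry

theorem sum_dual_mul_eq {I J K R : ℕ} {A A' : Matrix (Fin I) (Fin R) ℝ}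
    {B B' : Matrix (Fin J) (Fin R) ℝ} {C C' : Matrix (Fin K) (Fin R) ℝ}
    (h : cpdTensor A B C = cpdTensor A' B' C') (φ : Module.Dual ℝ (Fin K → ℝ)) (i : Fin I)
    (j : Fin J) :
    ∑ r, A i r * B j r * φ (C.col r) = ∑ r, A' i r * B' j r * φ (C'.col r) := by
  have apply_dual (A : Matrix (Fin I) (Fin R) ℝ) (B : Matrix (Fin J) (Fin R) ℝ)
      (C : Matrix (Fin K) (Fin R) ℝ) :
      φ (cpdTensor A B C i j) = ∑ r, A i r * B j r * φ (C.col r) := by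
    have hsum : cpdTensor A B C i j = ∑ r, (A i r * B j r) • C.col r := by
      ext k
      simp [cpdTensor]
    simp [hsum]
  rw [← apply_dual, ← apply_dual, h]

open Matrix in
theorem mul_diagonal_dual_mul_transpose_eq {I J K R : ℕ} {A A' : Matrix (Fin I) (Fin R) ℝ}
    {B B' : Matrix (Fin J) (Fin R) ℝ} {C C' : Matrix (Fin K) (Fin R) ℝ}
    (h : cpdTensor A B C = cpdTensor A' B' C') (φ : Module.Dual ℝ (Fin K → ℝ)) :
    A * diagonal (fun r => φ (C.col r)) * Bᵀ = A' * diagonal (fun r => φ (C'.col r)) * B'ᵀ := by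
  ext i j
  simpa only [mul_apply (N := Bᵀ), mul_apply (N := B'ᵀ), mul_diagonal, transpose_apply,
    mul_right_comm] using sum_dual_mul_eq h φ i j

theorem sum_dual_mul_dual_smul_eq {I J K R : ℕ} {A A' : Matrix (Fin I) (Fin R) ℝ}
    {B B' : Matrix (Fin J) (Fin R) ℝ} {C C' : Matrix (Fin K) (Fin R) ℝ}
    (h : cpdTensor A B C = cpdTensor A' B' C') (φ : Module.Dual ℝ (Fin K → ℝ))
    (y : Module.Dual ℝ (Fin J → ℝ)) :
    ∑ r, (φ (C.col r) * y (B.col r)) • A.col r =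
      ∑ r, (φ (C'.col r) * y (B'.col r)) • A'.col r := by
  ext i
  have apply_dual (A : Matrix (Fin I) (Fin R) ℝ) (B : Matrix (Fin J) (Fin R) ℝ)
      (C : Matrix (Fin K) (Fin R) ℝ) :
      y (fun j => ∑ r, A i r * B j r * φ (C.col r)) =
        (∑ r, (φ (C.col r) * y (B.col r)) • A.col r) i := by
    have hsum : (fun j => ∑ r, A i r * B j r * φ (C.col r)) =
        ∑ r, (A i r * φ (C.col r)) • B.col r := by
      ext j
      simp [mul_right_comm]
    rw [hsum]
    simp only [map_sum, map_smul, smul_eq_mul, Finset.sum_apply, Pi.smul_apply, Matrix.col_apply]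
    exact Finset.sum_congr rfl fun r _ => by ring
  rw [← apply_dual, ← apply_dual]
  congr 1
  ext j
  exact sum_dual_mul_eq h φ i j

/-- Uniqueness of the third factor matrix. -/
theorem exists_perm_smul_col_eq {I J K R : ℕ} {A A' : Matrix (Fin I) (Fin R) ℝ}
    {B B' : Matrix (Fin J) (Fin R) ℝ} {C C' : Matrix (Fin K) (Fin R) ℝ} (hC : 2 ≤ kRank C)
    (hAB : (khatriRao (compound (R - C.rank + 2) A) (compound (R - C.rank + 2) B)).rank =
      Nat.choose R (R - C.rank + 2))
    (h : cpdTensor A B C = cpdTensor A' B' C') :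
    ∃ (σ : Equiv.Perm (Fin R)) (l : Fin R → ℝ),
      ∀ r, l r ≠ 0 ∧ C'.col r = l r • C.col (σ r) := by
  have hRC : C.rank ≤ R := C.rank_le_width
  have hkR : kRank C ≤ R := by simpa using kRank_le_card C
  have hrank : C.rank = Module.finrank ℝ (Submodule.span ℝ (Set.range C.col)) :=
    C.rank_eq_finrank_span_cols
  have hC2 : 2 ≤ C.rank := by
    obtain ⟨s, -, hs⟩ := Finset.exists_superset_card_eq (s := (∅ : Finset (Fin R))) (n := 2)
      (by simp) (by simpa using hC.trans hkR)
    have hli := linearIndepOn_of_card_le_kRank (A := C) (s := s) (by omega)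
    have hfin := finrank_span_eq_card hli
    rw [← Set.image_eq_range] at hfin
    have := Submodule.finrank_mono (Submodule.span_mono (R := ℝ)
      (Set.image_subset_range C.col (s : Set (Fin R))))
    rw [← hrank, hfin] at this
    simpa [hs] using this
  refine exists_perm_smul_of_card_le ?_ ?_ ?_
  · intro i
    exact (linearIndepOn_of_card_le_kRank (A := C) (s := {i}) (by simp; omega)).ne_zero (by simp)
  · intro i j hij
    by_contra hne
    obtain ⟨φ, hφ, hφ0⟩ := (linearIndepOn_of_card_le_kRank (A := C) (s := {i, j})
      (Finset.card_le_two.trans hC)).exists_dual (i := i) (by simp)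
    obtain ⟨x, hx⟩ := Submodule.mem_span_singleton.1 hij
    rw [← hx, map_smul, hφ0 j (by simp) (Ne.symm hne), smul_zero] at hφ
    exact hφ rfl
  · intro φ hφ
    rw [← hrank] at hφ
    have e := mul_diagonal_dual_mul_transpose_eq h φ
    have hle := rank_mul_diagonal_mul_le A' B'.transpose fun r => φ (C'.col r)
    have split (v : Fin R → ℝ) : (Finset.univ.filter fun r => v r = 0).card +
        (Finset.univ.filter fun r => v r ≠ 0).card = R := by
      rw [Finset.card_filter_add_card_filter_not, Finset.card_fin]
    have s1 := split fun r => φ (C'.col r)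
    have s2 := split fun r => φ (C.col r)
    rw [← e] at hle
    have := card_support_le_rank (by omega) hAB (d := fun r => φ (C.col r)) (by omega)
    omega

/-- Uniqueness of the decomposition when the third factor matrix is unique. -/
theorem exists_perm_scaling_of_col_eq {I J K R : ℕ} {A A' : Matrix (Fin I) (Fin R) ℝ}
    {B B' : Matrix (Fin J) (Fin R) ℝ} {C C' : Matrix (Fin K) (Fin R) ℝ}
    (hk : R + 1 ≤ min (kRank A) (kRank B - 1) + kRank C) (hC : 2 ≤ kRank C)
    (h : cpdTensor A B C = cpdTensor A' B' C') {σ : Equiv.Perm (Fin R)} {l : Fin R → ℝ}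
    (hl : ∀ r, l r ≠ 0 ∧ C'.col r = l r • C.col (σ r)) :
    ∃ (σ : Equiv.Perm (Fin R)) (la lb lc : Fin R → ℝ),
      (∀ r, la r * lb r * lc r = 1) ∧
      (∀ i r, A' i r = la r * A i (σ r)) ∧
      (∀ j r, B' j r = lb r * B j (σ r)) ∧
      (∀ k r, C' k r = lc r * C k (σ r)) := by
  have hkR : kRank C ≤ R := by simpa using kRank_le_card C
  have hβ := exists_smul_eq_of_sum_smul_eq (a := A.col) (b := B.col) (c := C.col)
    (a' := fun s => l (σ.symm s) • A'.col (σ.symm s)) (b' := fun s => B'.col (σ.symm s))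
    (p := R + 1 - kRank C) (q := kRank C) (fun φ y => by
      rw [sum_dual_mul_dual_smul_eq h φ y]
      refine Eq.trans (Finset.sum_congr rfl fun r _ => ?_) (Equiv.sum_comp σ _)
      rw [(hl r).2, Equiv.symm_apply_apply, map_smul, smul_smul, smul_eq_mul]
      congr 1
      ring)
    (by omega) hC (by simp; omega)
    (fun s hs => linearIndepOn_of_card_le_kRank (by omega))
    (fun s hs => linearIndepOn_of_card_le_kRank (by omega))
    fun s hs => linearIndepOn_of_card_le_kRank hs
  choose β hβ0 hb ha using hβ
  refine ⟨σ, fun r => (β (σ r) * l r)⁻¹, fun r => β (σ r), l, fun r => ?_, fun i r => ?_,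
    fun j r => ?_, fun k r => congrFun (hl r).2 k⟩
  · have := hβ0 (σ r)
    have := (hl r).1
    field_simp
  · have := congrFun (ha (σ r)) i
    simp only [Equiv.symm_apply_apply, Pi.smul_apply, smul_eq_mul, Matrix.col_apply] at this
    have h1 := hβ0 (σ r)
    have h2 := (hl r).1
    rw [this]
    field_simp
  · simpa using congrFun (hb (σ r)) j

theorem exists_perm_scaling {I J K R : ℕ} {A A' : Matrix (Fin I) (Fin R) ℝ}
    {B B' : Matrix (Fin J) (Fin R) ℝ} {C C' : Matrix (Fin K) (Fin R) ℝ} (hC : 2 ≤ kRank C)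
    (hk : R + 1 ≤ max (min (kRank A) (kRank B - 1)) (min (kRank A - 1) (kRank B)) + kRank C)
    (hAB : (khatriRao (compound (R - C.rank + 2) A) (compound (R - C.rank + 2) B)).rank =
      Nat.choose R (R - C.rank + 2))
    (h : cpdTensor A B C = cpdTensor A' B' C') :
    ∃ (σ : Equiv.Perm (Fin R)) (la lb lc : Fin R → ℝ),
      (∀ r, la r * lb r * lc r = 1) ∧
      (∀ i r, A' i r = la r * A i (σ r)) ∧
      (∀ j r, B' j r = lb r * B j (σ r)) ∧
      (∀ k r, C' k r = lc r * C k (σ r)) := by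
  obtain ⟨σ, l, hl⟩ := exists_perm_smul_col_eq hC hAB h
  rcases le_total (min (kRank A - 1) (kRank B)) (min (kRank A) (kRank B - 1)) with hle | hle
  · rw [max_eq_left hle] at hk
    exact exists_perm_scaling_of_col_eq hk hC h hl
  · rw [max_eq_right hle, min_comm] at hk
    have hswap : cpdTensor B A C = cpdTensor B' A' C' := by
      ext j i k
      have := congrFun (congrFun (congrFun h i) j) k
      simpa only [cpdTensor, mul_comm (B _ _) (A _ _), mul_comm (B' _ _) (A' _ _)] using this
    obtain ⟨τ, lb, la, lc, h1, hb, ha, hc⟩ := exists_perm_scaling_of_col_eq hk hC hswap hl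
    exact ⟨τ, la, lb, lc, fun r => by rw [mul_comm (la r), h1], ha, hb, hc⟩

/-- A decomposition can be padded with zero terms. -/
theorem exists_cpdTensor_eq_of_lt {I J K n R : ℕ} (hn : n < R) (A : Matrix (Fin I) (Fin n) ℝ)
    (B : Matrix (Fin J) (Fin n) ℝ) (C : Matrix (Fin K) (Fin n) ℝ) :
    ∃ (A' : Matrix (Fin I) (Fin R) ℝ) (B' : Matrix (Fin J) (Fin R) ℝ)
      (C' : Matrix (Fin K) (Fin R) ℝ),
      cpdTensor A B C = cpdTensor A' B' C' ∧ ∃ r, ∀ k, C' k r = 0 := by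
  obtain ⟨k, rfl⟩ : ∃ k, R = n + (k + 1) := ⟨R - n - 1, by omega⟩
  refine ⟨fun i => Fin.append (A i) (0 : Fin (k + 1) → ℝ),
    fun j => Fin.append (B j) (0 : Fin (k + 1) → ℝ),
    fun l => Fin.append (C l) (0 : Fin (k + 1) → ℝ), ?_, Fin.natAdd n (0 : Fin (k + 1)), ?_⟩
  · ext i j l
    simp only [cpdTensor]
    rw [show (∑ r, Fin.append (A i) (0 : Fin (k + 1) → ℝ) r * Fin.append (B j) 0 r *
      Fin.append (C l) 0 r) = _ from Fin.sum_univ_add (a := n) (b := k + 1) _]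
    simp
  · intro l
    exact Fin.append_right _ _ _

/-- Let `m := R − r_C + 2`. If
`max (min k_A (k_B − 1)) (min (k_A − 1) k_B) + k_C ≥ R + 1` and the Khatri–Rao product
`C_m(A) ⊙ C_m(B)` of the `m`-th compound matrices has full column rank (`= C(R,m)`),
then the rank of `T = [A,B,C]_R` equals `R` and the CPD of `T` is unique. -/
theorem stmt3 {I J K R m : ℕ} (A : Matrix (Fin I) (Fin R) ℝ) (B : Matrix (Fin J) (Fin R) ℝ)
    (C : Matrix (Fin K) (Fin R) ℝ)
    (hm : m = R - C.rank + 2)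
    (h1 : R + 1 ≤ max (min (kRank A) (kRank B - 1)) (min (kRank A - 1) (kRank B)) + kRank C)
    (h2 : (khatriRao (compound m A) (compound m B)).rank = Nat.choose R m) :
    tensorRank (cpdTensor A B C) = R ∧ cpdUnique R (cpdTensor A B C) := by
  subst hm
  have hA : kRank A ≤ R := by simpa using kRank_le_card A
  have hB : kRank B ≤ R := by simpa using kRank_le_card B
  have hCR : kRank C ≤ R := by simpa using kRank_le_card C
  have hC : 2 ≤ kRank C := by omega
  constructor
  · refine le_antisymm (Nat.sInf_le ⟨A, B, C, rfl⟩) (le_csInf ⟨R, A, B, C, rfl⟩ ?_)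
    rintro n ⟨A₁, B₁, C₁, h⟩
    by_contra! hn
    obtain ⟨A', B', C', h', r, hr⟩ := exists_cpdTensor_eq_of_lt hn A₁ B₁ C₁
    obtain ⟨σ, la, lb, lc, hprod, -, -, hc⟩ := exists_perm_scaling hC h1 h2 (h.trans h')
    have hlc : lc r ≠ 0 := right_ne_zero_of_mul_eq_one (hprod r)
    have hne := (linearIndepOn_of_card_le_kRank (A := C) (s := {σ r}) (by simp; omega)).ne_zero
      (i := σ r) (by simp)
    refine hne (funext fun k => ?_)
    have := hc k r
    rw [hr k] at this
    simpa [hlc] using this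
  · intro A₁ A₂ B₁ B₂ C₁ C₂ e₁ e₂
    obtain ⟨σ, a, b, c, hprod, hA₁, hB₁, hC₁⟩ := exists_perm_scaling hC h1 h2 e₁
    obtain ⟨τ, a', b', c', hprod', hA₂, hB₂, hC₂⟩ := exists_perm_scaling hC h1 h2 e₂
    have ha (r) : a r ≠ 0 := fun h => by simpa [h] using hprod r
    have hb (r) : b r ≠ 0 := fun h => by simpa [h] using hprod r
    have hc (r) : c r ≠ 0 := fun h => by simpa [h] using hprod r
    refine ⟨τ.trans σ.symm, fun r => a' r / a (σ.symm (τ r)), fun r => b' r / b (σ.symm (τ r)),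
      fun r => c' r / c (σ.symm (τ r)), fun r => ?_, fun i r => ?_, fun j r => ?_, fun k r => ?_⟩
    · rw [div_mul_div_comm, div_mul_div_comm, hprod, hprod', div_one]
    · have := ha (σ.symm (τ r))
      simp only [hA₁, hA₂, Equiv.trans_apply, Equiv.apply_symm_apply]
      field_simp
    · have := hb (σ.symm (τ r))
      simp only [hB₁, hB₂, Equiv.trans_apply, Equiv.apply_symm_apply]
      field_simp
    · have := hc (σ.symm (τ r))
      simp only [hC₁, hC₂, Equiv.trans_apply, Equiv.apply_symm_apply]
      field_simp
end
end

section
/- Let C ∈ ℝ^{K×R} with K ≤ R, set m := R − K + 2, and suppose the k-rank of C satisfies k_C = K. Then {v ∈ range(π_S) : R_m(C)^T v = 0} = range(B(C)^{(m)}), i.e. the kernel of the restriction of R_m(C)^T to the range of the symmetrizer π_S equals the column space of the m-fold Khatri–Rao power of B(C). -/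
open scoped BigOperators

noncomputable section

/-- The permanent of a square matrix. -/
def permanent {n : ℕ} (A : Matrix (Fin n) (Fin n) ℝ) : ℝ :=
  ∑ σ : Equiv.Perm (Fin n), ∏ i, A i (σ i)

/-- The matrix `R_m(C)`: rows are indexed by tuples `(i_1,…,i_m) ∈ {1,…,K}^m`, columns by
`m`-element subsets `{j_1 < … < j_m}` of the columns of `C`, and the corresponding entry
is the permanent of the `m × m` submatrix of `C` on rows `i_1,…,i_m` and columns
`j_1,…,j_m`. -/
def Rmat {K R : ℕ} (m : ℕ) (C : Matrix (Fin K) (Fin R) ℝ) :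
    Matrix (Fin m → Fin K) {t : Finset (Fin R) // t.card = m} ℝ :=
  Matrix.of fun i t =>
    permanent (Matrix.of fun a b : Fin m => C (i a) (t.1.orderIsoOfFin t.2 b : Fin R))


/-- The symmetrizer `π_S : ℝ^{K^m} → ℝ^{K^m}` as a linear map (identifying `ℝ^{K^m}` with
functions on index tuples): `(π_S v) i = (1/m!) ∑_{σ ∈ S_m} v (i ∘ σ)`, so that
`π_S(t_1 ⊗ … ⊗ t_m) = (1/m!) ∑_{σ ∈ S_m} t_{σ(1)} ⊗ … ⊗ t_{σ(m)}`. -/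
noncomputable def piSLin (K m : ℕ) :
    ((Fin m → Fin K) → ℝ) →ₗ[ℝ] ((Fin m → Fin K) → ℝ) :=
  (m.factorial : ℝ)⁻¹ •
    ∑ σ : Equiv.Perm (Fin m), LinearMap.funLeft ℝ ℝ (fun i : Fin m → Fin K => i ∘ σ)

/-- The matrix `B(C) = L · C_{K−1}(C) ∈ ℝ^{K × C(R,K−1)}`, where `C_{K−1}(C)` is the
`(K−1)`-st compound matrix of `C` (with the lexicographic index conventions) and `L` is the
`K × K` anti-diagonal matrix with `L_{K+1−j, j} = (−1)^{j−1}`.  Written out entrywise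
(with rows indexed `0`-based by `k : Fin K` and columns by `(K−1)`-element subsets `t` of
the columns of `C`), its `(k, t)` entry is `(−1)^(K−1−k)` times the minor of `C` on the
rows `{0,…,K−1} \ {k}` and the columns `t`. -/
def BC {K R : ℕ} (C : Matrix (Fin K) (Fin R) ℝ) :
    Matrix (Fin K) {t : Finset (Fin R) // t.card = K - 1} ℝ :=
  Matrix.of fun k t =>
    (-1 : ℝ) ^ (K - 1 - (k : ℕ)) *
      Matrix.det (Matrix.of fun a b : Fin (K - 1) =>
        C ((Finset.univ.erase k).orderIsoOfFin
            (by simp [Finset.card_erase_of_mem]) a : Fin K)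
          (t.1.orderIsoOfFin t.2 b : Fin R))

/-- The `n`-fold Khatri–Rao power of a matrix `M` with `K` rows: the matrix whose rows are
indexed by tuples `(i_1,…,i_n) ∈ {1,…,K}^n` and whose columns are the `n`-fold Kronecker
powers of the columns of `M`. -/
def krPow {K : ℕ} {κ : Type*} (n : ℕ) (M : Matrix (Fin K) κ ℝ) :
    Matrix (Fin n → Fin K) κ ℝ :=
  Matrix.of fun i t => ∏ a, M (i a) t

/-- A multilinear form vanishing when its first argument lies in a spanning set, the others being
fixed, vanishes for every first argument. -/
theorem MultilinearMap.cons_eq_zero_of_span_eq_top {E : Type*} [AddCommGroup E] [Module ℝ E]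
    {n : ℕ} (f : MultilinearMap ℝ (fun _ : Fin (n + 1) => E) ℝ) {S : Set E}
    (hS : Submodule.span ℝ S = ⊤) (z : Fin n → E)
    (h : ∀ y ∈ S, f (Fin.cons y z) = 0) (y : E) : f (Fin.cons y z) = 0 := by
  have hzero : f.toLinearMap (Fin.cons 0 z) 0 = 0 :=
    LinearMap.ext_on hS fun y hy => by simpa [Fin.update_cons_zero] using h y hy
  simpa [Fin.update_cons_zero] using LinearMap.congr_fun hzero y

/-- If every set of at least `d` of the vectors `c i` spans the space, then a multilinear form in
`n ≤ |ι| + 1 - d` variables which vanishes at all tuples of distinct vectors `c i` is zero. -/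
theorem MultilinearMap.eq_zero_of_forall_injective {ι E : Type*} [Fintype ι] [DecidableEq ι]
    [AddCommGroup E] [Module ℝ E] {c : ι → E} {d : ℕ}
    (hc : ∀ s : Finset ι, d ≤ s.card → Submodule.span ℝ (c '' s) = ⊤) {n : ℕ}
    (hn : n + d ≤ Fintype.card ι + 1) (f : MultilinearMap ℝ (fun _ : Fin n => E) ℝ)
    (hf : ∀ j : Fin n → ι, Function.Injective j → f (fun a => c (j a)) = 0) : f = 0 := by
  induction n with
  | zero =>
    ext x
    rw [Subsingleton.elim x fun a => c (Fin.elim0 a)]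
    exact hf (fun a => Fin.elim0 a) fun a => Fin.elim0 a
  | succ n ih =>
    have key : ∀ x, f.curryLeft x = 0 := by
      intro x
      refine ih (by omega) _ fun j hj => ?_
      have hs : d ≤ (Finset.univ.image j)ᶜ.card := by
        rw [Finset.card_compl, Finset.card_image_of_injective _ hj, Finset.card_univ,
          Fintype.card_fin]
        omega
      refine f.cons_eq_zero_of_span_eq_top (hc _ hs) _ ?_ x
      rintro _ ⟨i, hi, rfl⟩
      have hi' : ∀ a, j a ≠ i := by simpa using hi
      have h := hf (Fin.cons i j) (Fin.cons_injective_iff.2 ⟨by simpa using hi', hj⟩)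
      have hcons : (fun a => c ((Fin.cons i j : Fin (n + 1) → ι) a)) =
          Fin.cons (c i) fun a => c (j a) := by
        ext a
        refine Fin.cases ?_ (fun a => ?_) a <;> simp
      rwa [hcons] at h
    ext x
    have h := congrArg (fun g => g (Fin.tail x)) (key (x 0))
    simpa using h

/-- The multilinear form whose coefficient tensor in the standard basis is `v`. -/
def tensorForm {K m : ℕ} (v : (Fin m → Fin K) → ℝ) :
    MultilinearMap ℝ (fun _ : Fin m => Fin K → ℝ) ℝ :=
  ∑ i, v i • (MultilinearMap.mkPiAlgebra ℝ (Fin m) ℝ).compLinearMap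
    fun a => LinearMap.proj (i a)

theorem tensorForm_apply {K m : ℕ} (v : (Fin m → Fin K) → ℝ) (x : Fin m → Fin K → ℝ) :
    tensorForm v x = ∑ i, v i * ∏ a, x a (i a) := by
  simp [tensorForm]

theorem tensorForm_sub {K m : ℕ} (v w : (Fin m → Fin K) → ℝ) :
    tensorForm (v - w) = tensorForm v - tensorForm w := by
  ext x
  simp [tensorForm_apply, sub_mul]

theorem tensorForm_single {K m : ℕ} (v : (Fin m → Fin K) → ℝ) (i : Fin m → Fin K) :
    tensorForm v (fun a => Pi.single (i a) 1) = v i := by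
  rw [tensorForm_apply, Finset.sum_eq_single i]
  · simp
  · intro j _ hj
    obtain ⟨a, ha⟩ := Function.ne_iff.1 hj
    rw [Finset.prod_eq_zero (Finset.mem_univ a) (by simp [ha]), mul_zero]
  · simp

theorem tensorForm_injective {K m : ℕ} :
    Function.Injective (tensorForm : ((Fin m → Fin K) → ℝ) → _) := by
  intro v w h
  ext i
  rw [← tensorForm_single v, h, tensorForm_single]

theorem tensorForm_comp_perm {K m : ℕ} {v : (Fin m → Fin K) → ℝ}
    (hv : ∀ (σ : Equiv.Perm (Fin m)) i, v (i ∘ σ) = v i) (σ : Equiv.Perm (Fin m))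
    (x : Fin m → Fin K → ℝ) : tensorForm v (fun a => x (σ a)) = tensorForm v x := by
  rw [tensorForm_apply, tensorForm_apply,
    ← (σ.symm.arrowCongr (Equiv.refl (Fin K))).sum_comp]
  refine Finset.sum_congr rfl fun i _ => ?_
  have hi : σ.symm.arrowCongr (Equiv.refl (Fin K)) i = i ∘ σ := by
    ext a
    simp
  rw [hi, hv]
  congr 1
  exact Equiv.prod_comp σ fun a => x a (i a)

theorem tensorForm_krPow {K m : ℕ} {κ : Type*} [Fintype κ] (M : Matrix (Fin K) κ ℝ)
    (μ : κ → ℝ) (x : Fin m → Fin K → ℝ) :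
    tensorForm (Matrix.mulVecLin (krPow m M) μ) x =
      ∑ t, μ t * ∏ a, ((fun k => M k t) ⬝ᵥ x a) := by
  simp only [tensorForm_apply, Matrix.mulVecLin_apply, Matrix.mulVec, dotProduct, krPow,
    Matrix.of_apply, Fintype.prod_sum, Finset.sum_mul, Finset.mul_sum, Finset.prod_mul_distrib]
  rw [Finset.sum_comm]
  refine Finset.sum_congr rfl fun t _ => Finset.sum_congr rfl fun i _ => ?_
  ring

theorem piSLin_apply {K m : ℕ} (v : (Fin m → Fin K) → ℝ) (i : Fin m → Fin K) :
    piSLin K m v i = (m.factorial : ℝ)⁻¹ * ∑ σ : Equiv.Perm (Fin m), v (i ∘ σ) := by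
  simp [piSLin, LinearMap.funLeft_apply]

theorem mem_range_piSLin_iff {K m : ℕ} (v : (Fin m → Fin K) → ℝ) :
    v ∈ LinearMap.range (piSLin K m) ↔
      ∀ (σ : Equiv.Perm (Fin m)) i, v (i ∘ σ) = v i := by
  constructor
  · rintro ⟨w, rfl⟩ σ i
    rw [piSLin_apply, piSLin_apply]
    congr 1
    exact Equiv.sum_comp (Equiv.mulLeft σ) fun τ : Equiv.Perm (Fin m) => w (i ∘ τ)
  · intro hv
    refine ⟨v, ?_⟩
    ext i
    rw [piSLin_apply]
    simp only [hv]
    have : (m.factorial : ℝ) ≠ 0 := by exact_mod_cast m.factorial_ne_zero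
    simp [Fintype.card_perm, this]

theorem vecMul_Rmat_apply {K R m : ℕ} (C : Matrix (Fin K) (Fin R) ℝ)
    (v : (Fin m → Fin K) → ℝ) (t : {t : Finset (Fin R) // t.card = m}) :
    Matrix.vecMul v (Rmat m C) t =
      ∑ σ : Equiv.Perm (Fin m), tensorForm v fun a => C.col (t.1.orderEmbOfFin t.2 (σ a)) := by
  simp only [Matrix.vecMul, dotProduct, Rmat, permanent, Matrix.of_apply, tensorForm_apply,
    Finset.mul_sum]
  rw [Finset.sum_comm]
  rfl

theorem exists_perm_forall_eq {R m : ℕ} {j : Fin m → Fin R}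
    (hj : Function.Injective j) {s : Fin m → Fin R}
    (h : Set.range j = Set.range s) : ∃ σ : Equiv.Perm (Fin m), ∀ a, j a = s (σ a) := by
  have h1 : ∀ a, ∃ b, j a = s b := fun a => by
    obtain ⟨b, hb⟩ : j a ∈ Set.range s := h ▸ Set.mem_range_self a
    exact ⟨b, hb.symm⟩
  choose f hf using h1
  have hfi : Function.Injective f := fun a b hab => hj (by rw [hf, hf, hab])
  exact ⟨Equiv.ofBijective f (Finite.injective_iff_bijective.1 hfi), hf⟩

/-- A symmetric tensor is annihilated by `Rmat m C` iff its form vanishes at all tuples of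
distinct columns of `C`. -/
theorem vecMul_Rmat_eq_zero_iff {K R m : ℕ} (C : Matrix (Fin K) (Fin R) ℝ)
    {v : (Fin m → Fin K) → ℝ} (hv : ∀ (σ : Equiv.Perm (Fin m)) i, v (i ∘ σ) = v i) :
    Matrix.vecMul v (Rmat m C) = 0 ↔
      ∀ j : Fin m → Fin R, Function.Injective j → tensorForm v (fun a => C.col (j a)) = 0 := by
  constructor
  · intro h j hj
    have hcard : (Finset.univ.image j).card = m := by
      rw [Finset.card_image_of_injective _ hj, Finset.card_univ, Fintype.card_fin]
    have ht := congrFun h ⟨_, hcard⟩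
    obtain ⟨σ, hσ⟩ := exists_perm_forall_eq hj
      (s := (Finset.univ.image j).orderEmbOfFin hcard) (by simp)
    rw [vecMul_Rmat_apply] at ht
    simp only [tensorForm_comp_perm hv _
      (fun a => C.col ((Finset.univ.image j).orderEmbOfFin hcard a))] at ht
    simp only [hσ, tensorForm_comp_perm hv _
      (fun a => C.col ((Finset.univ.image j).orderEmbOfFin hcard a))]
    simpa [Fintype.card_perm, Nat.factorial_ne_zero] using ht
  · intro h
    ext t
    rw [vecMul_Rmat_apply]
    exact Finset.sum_eq_zero fun σ _ =>
      h _ ((t.1.orderEmbOfFin t.2).injective.comp σ.injective)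

theorem linearIndependent_col_of_kRank_eq {K R : ℕ} {C : Matrix (Fin K) (Fin R) ℝ}
    (hC : kRank C = K) (s : Finset (Fin R)) (hs : s.card = K) :
    LinearIndependent ℝ fun j : s => C.col j := by
  have hmem := Nat.sSup_mem (s := {k | k ≤ Fintype.card (Fin R) ∧
    ∀ s : Finset (Fin R), s.card = k → LinearIndependent ℝ fun j : s => fun i => C i j.1})
    ⟨0, by simp, fun s hs => by
      have : IsEmpty s := by simpa [Finset.isEmpty_coe_sort] using hs
      exact linearIndependent_empty_type⟩ ⟨_, fun k hk => hk.1⟩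
  exact hmem.2 s (hs.trans hC.symm)

theorem span_image_col_eq_top {K R : ℕ} {C : Matrix (Fin K) (Fin R) ℝ}
    (hC : kRank C = K) (s : Finset (Fin R)) (hs : K ≤ s.card) :
    Submodule.span ℝ (C.col '' s) = ⊤ := by
  obtain ⟨t, hts, ht⟩ := Finset.exists_subset_card_eq hs
  have hli := linearIndependent_col_of_kRank_eq hC t ht
  have htop := hli.span_eq_top_of_card_eq_finrank' (by simp [ht])
  refine top_le_iff.1 (htop ▸ Submodule.span_mono ?_)
  rintro _ ⟨j, rfl⟩
  exact ⟨j, hts j.2, rfl⟩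

theorem dotProduct_BC {K R : ℕ} (C : Matrix (Fin (K + 1)) (Fin R) ℝ)
    (t : {t : Finset (Fin R) // t.card = K}) (j : Fin R) :
    (fun k => BC C k t) ⬝ᵥ C.col j =
      (C.submatrix id (Fin.snoc (t.1.orderEmbOfFin t.2) j : Fin (K + 1) → Fin R)).det := by
  rw [Matrix.det_succ_column _ (Fin.last K), dotProduct]
  refine Finset.sum_congr rfl fun k _ => ?_
  have hsign : (-1 : ℝ) ^ (K + 1 - 1 - (k : ℕ)) = (-1) ^ ((k : ℕ) + (Fin.last K : ℕ)) := by
    have hk : (k : ℕ) ≤ K := by omega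
    rw [Fin.val_last]
    obtain ⟨d, hd⟩ := Nat.exists_eq_add_of_le hk
    rw [show K + 1 - 1 - (k : ℕ) = d by omega,
      show (k : ℕ) + K = 2 * k + d by omega, pow_add, pow_mul]
    simp
  have hrow : ∀ a : Fin K, ((Finset.univ.erase k).orderIsoOfFin
      (by simp [Finset.card_erase_of_mem]) a : Fin (K + 1)) = k.succAbove a := by
    have h := Finset.orderEmbOfFin_unique (s := Finset.univ.erase k) (k := K)
      (by simp [Finset.card_erase_of_mem]) (f := k.succAbove)
      (fun a => by simp [Fin.succAbove_ne]) (Fin.strictMono_succAbove k)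
    intro a
    rw [h]
    rfl
  have hdet : Matrix.det (Matrix.of fun a b : Fin K =>
        C ((Finset.univ.erase k).orderIsoOfFin
            (by simp [Finset.card_erase_of_mem]) a : Fin (K + 1))
          (t.1.orderIsoOfFin t.2 b : Fin R)) =
      ((C.submatrix id (Fin.snoc (t.1.orderEmbOfFin t.2) j : Fin (K + 1) → Fin R)).submatrix
        k.succAbove (Fin.last K).succAbove).det := by
    congr 1
    ext a b
    simp [hrow, Fin.succAbove_last]
  have hBC : BC C k t = (-1 : ℝ) ^ (K + 1 - 1 - (k : ℕ)) *
      Matrix.det (Matrix.of fun a b : Fin K =>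
        C ((Finset.univ.erase k).orderIsoOfFin
            (by simp [Finset.card_erase_of_mem]) a : Fin (K + 1))
          (t.1.orderIsoOfFin t.2 b : Fin R)) := rfl
  rw [hBC, hsign, hdet]
  simp only [Matrix.submatrix_apply, Fin.snoc_last, Matrix.col_apply, id]
  ring

theorem dotProduct_BC_eq_zero_iff {K R : ℕ} {C : Matrix (Fin (K + 1)) (Fin R) ℝ}
    (hC : kRank C = K + 1) (t : {t : Finset (Fin R) // t.card = K}) (j : Fin R) :
    (fun k => BC C k t) ⬝ᵥ C.col j = 0 ↔ j ∈ t.1 := by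
  rw [dotProduct_BC]
  constructor
  · contrapose!
    intro hj
    have hinj : Function.Injective
        (Fin.snoc (t.1.orderEmbOfFin t.2) j : Fin (K + 1) → Fin R) :=
      Fin.snoc_injective_iff.2 ⟨(t.1.orderEmbOfFin t.2).injective, by simpa using hj⟩
    have hli := linearIndependent_col_of_kRank_eq hC (Finset.univ.image
      (Fin.snoc (t.1.orderEmbOfFin t.2) j : Fin (K + 1) → Fin R))
      (by rw [Finset.card_image_of_injective _ hinj, Finset.card_univ, Fintype.card_fin])
    have hli' := hli.comp (fun a => ⟨_, Finset.mem_image_of_mem _ (Finset.mem_univ a)⟩)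
      fun a b hab => hinj (congrArg Subtype.val hab)
    have hunit := Matrix.linearIndependent_cols_iff_isUnit.1
      (show LinearIndependent ℝ (C.submatrix id
        (Fin.snoc (t.1.orderEmbOfFin t.2) j : Fin (K + 1) → Fin R)).col from hli')
    exact ((Matrix.isUnit_iff_isUnit_det _).1 hunit).ne_zero
  · intro hj
    have hj' : j ∈ Set.range (t.1.orderEmbOfFin t.2) := by simpa using hj
    obtain ⟨a, ha⟩ := hj'
    refine Matrix.det_zero_of_column_eq (Fin.castSucc_lt_last a).ne fun k => ?_
    simp [ha]

theorem mulVecLin_krPow_comp_perm {K m : ℕ} {κ : Type*} [Fintype κ] (M : Matrix (Fin K) κ ℝ)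
    (μ : κ → ℝ) (σ : Equiv.Perm (Fin m)) (i : Fin m → Fin K) :
    Matrix.mulVecLin (krPow m M) μ (i ∘ σ) = Matrix.mulVecLin (krPow m M) μ i := by
  simp only [Matrix.mulVecLin_apply, Matrix.mulVec, dotProduct, krPow, Matrix.of_apply]
  refine Finset.sum_congr rfl fun t _ => ?_
  congr 1
  exact Equiv.prod_comp σ fun a => M (i a) t

theorem prod_dotProduct_BC_eq_zero {K R n : ℕ} {C : Matrix (Fin (K + 1)) (Fin R) ℝ}
    (hC : kRank C = K + 1) (hR : R < n + K) (t : {t : Finset (Fin R) // t.card = K})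
    {j : Fin n → Fin R} (hj : Function.Injective j) :
    ∏ a, ((fun k => BC C k t) ⬝ᵥ C.col (j a)) = 0 := by
  have hnd : ¬ Disjoint (Finset.univ.image j) t.1 := fun hd => by
    have h := Finset.card_le_univ ((Finset.univ.image j) ∪ t.1)
    rw [Finset.card_union_of_disjoint hd, Finset.card_image_of_injective _ hj, t.2,
      Finset.card_univ, Fintype.card_fin, Fintype.card_fin] at h
    omega
  obtain ⟨_, hi, hit⟩ := Finset.not_disjoint_iff.1 hnd
  obtain ⟨a, -, rfl⟩ := Finset.mem_image.1 hi
  exact Finset.prod_eq_zero (Finset.mem_univ a) ((dotProduct_BC_eq_zero_iff hC t _).2 hit)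

/-- A symmetric form in `R - K + 1` variables on `ℝ^(K+1)` vanishing at all tuples of distinct
columns of `C` is a combination of powers of the columns of `BC C`. -/
theorem mem_range_krPow_BC {K R n : ℕ} {C : Matrix (Fin (K + 1)) (Fin R) ℝ}
    (hC : kRank C = K + 1) (hR : R = n + K) (hn : 0 < n) {v : (Fin (n + 1) → Fin (K + 1)) → ℝ}
    (hv : ∀ (σ : Equiv.Perm (Fin (n + 1))) i, v (i ∘ σ) = v i)
    (h : ∀ j : Fin (n + 1) → Fin R, Function.Injective j →
      tensorForm v (fun a => C.col (j a)) = 0) :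
    v ∈ LinearMap.range (Matrix.mulVecLin (krPow (n + 1) (BC C))) := by
  have hex : ∀ t : {t : Finset (Fin R) // t.card = K}, ∃ s : Fin n → Fin R,
      Set.range s = (t.1 : Set (Fin R))ᶜ := fun t => by
    have hcard : t.1ᶜ.card = n := by
      rw [Finset.card_compl, t.2, Fintype.card_fin]
      omega
    exact ⟨t.1ᶜ.orderEmbOfFin hcard, by simp⟩
  choose s hsr using hex
  let x : {t : Finset (Fin R) // t.card = K} → Fin (n + 1) → Fin R :=
    fun t => Fin.cons (s t ⟨0, hn⟩) (s t)
  let p := fun t u : {t : Finset (Fin R) // t.card = K} =>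
    ∏ a, ((fun k => BC C k t) ⬝ᵥ C.col (x u a))
  let μ := fun t => tensorForm v (fun a => C.col (x t a)) / p t t
  let w := Matrix.mulVecLin (krPow (n + 1) (BC C)) μ
  have hxt : ∀ u a, x u a ∉ u.1 := fun u a => by
    have hsu : ∀ b, s u b ∉ u.1 := fun b => by
      have : s u b ∈ (u.1 : Set (Fin R))ᶜ := hsr u ▸ Set.mem_range_self b
      simpa using this
    refine Fin.cases ?_ (fun a => ?_) a
    · simpa [x] using hsu _
    · simpa [x] using hsu _
  have hpp : ∀ t, p t t ≠ 0 := fun t => Finset.prod_ne_zero_iff.2 fun a _ =>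
    mt (dotProduct_BC_eq_zero_iff hC t _).1 (hxt t a)
  have hp : ∀ t u, t ≠ u → p t u = 0 := by
    intro t u htu
    obtain ⟨i, hit, hiu⟩ : ∃ i ∈ t.1, i ∉ u.1 := by
      by_contra! hcon
      exact htu (Subtype.ext (Finset.eq_of_subset_of_card_le hcon (by rw [t.2, u.2])))
    have hi : i ∈ Set.range (s u) := by simpa [hsr] using hiu
    obtain ⟨b, rfl⟩ := hi
    refine Finset.prod_eq_zero (Finset.mem_univ b.succ) ?_
    simpa [x] using (dotProduct_BC_eq_zero_iff hC t _).2 hit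
  have hwv : ∀ u, tensorForm (v - w) (fun a => C.col (x u a)) = 0 := by
    intro u
    rw [tensorForm_sub, sub_apply, tensorForm_krPow, sub_eq_zero]
    exact ((Finset.sum_eq_single u (fun t _ htu => mul_eq_zero_of_right (μ t) (hp t u htu))
      (fun hu => absurd (Finset.mem_univ u) hu)).trans (div_mul_cancel₀ _ (hpp u))).symm
  have hsymm : ∀ (σ : Equiv.Perm (Fin (n + 1))) i, (v - w) (i ∘ σ) = (v - w) i := fun σ i =>
    congrArg₂ (· - ·) (hv σ i) (mulVecLin_krPow_comp_perm _ _ σ i)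
  have hdist : ∀ j : Fin (n + 1) → Fin R, Function.Injective j →
      tensorForm (v - w) (fun a => C.col (j a)) = 0 := by
    intro j hj
    rw [tensorForm_sub, sub_apply, h j hj, tensorForm_krPow, zero_sub, neg_eq_zero]
    exact Finset.sum_eq_zero fun t _ => mul_eq_zero_of_right _
      (prod_dotProduct_BC_eq_zero hC (by omega) t hj)
  have hcons : ∀ (i : Fin R) (j : Fin n → Fin R),
      (fun a => C.col ((Fin.cons i j : Fin (n + 1) → Fin R) a)) =
        Fin.cons (C.col i) fun a => C.col (j a) := fun i j => by
    ext a
    refine Fin.cases ?_ (fun a => ?_) a <;> simp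
  have hcurry : ∀ y, (tensorForm (v - w)).curryLeft y = 0 := by
    intro y
    refine MultilinearMap.eq_zero_of_forall_injective (span_image_col_eq_top hC)
      (by rw [Fintype.card_fin]; omega) _ fun j hj => ?_
    let u : {t : Finset (Fin R) // t.card = K} := ⟨(Finset.univ.image j)ᶜ, by
      rw [Finset.card_compl, Finset.card_image_of_injective _ hj, Finset.card_univ,
        Fintype.card_fin, Fintype.card_fin]
      omega⟩
    obtain ⟨σ, hσ⟩ := exists_perm_forall_eq hj (s := s u) (by simp [hsr, u])
    have hu : s u ⟨0, hn⟩ ∉ u.1 := by simpa [x] using hxt u 0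
    have hspan := span_image_col_eq_top hC (insert (s u ⟨0, hn⟩) u.1)
      (by rw [Finset.card_insert_of_notMem hu, u.2])
    refine (tensorForm (v - w)).cons_eq_zero_of_span_eq_top hspan _ ?_ y
    rintro _ ⟨i, hi, rfl⟩
    rw [← hcons]
    rcases Finset.mem_insert.1 hi with rfl | hi
    · rw [← tensorForm_comp_perm hsymm (Equiv.Perm.decomposeFin.symm (0, σ⁻¹)), ← hwv u]
      congr 1
      ext a : 1
      refine Fin.cases ?_ (fun a => ?_) a <;> simp [x, hσ]
    · refine hdist _ (Fin.cons_injective_iff.2 ⟨?_, hj⟩)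
      simpa [u] using hi
  have hform : tensorForm v = tensorForm w := by
    rw [← sub_eq_zero, ← tensorForm_sub]
    refine MultilinearMap.ext fun y => ?_
    simpa using congrArg (fun g => g (Fin.tail y)) (hcurry (y 0))
  exact ⟨μ, (tensorForm_injective hform).symm⟩

/-- If `K ≤ R`, `m := R − K + 2` and `k_C = K`, then the kernel of the
restriction of `R_m(C)ᵀ` to the range of the symmetrizer `π_S`, i.e. the subspace
`{v ∈ range(π_S) : R_m(C)ᵀ v = 0}` of `ℝ^{K^m}`, equals the column space of the `m`-fold
Khatri–Rao power `B(C)^{(m)}`. -/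
theorem stmt14 {K R m : ℕ} (C : Matrix (Fin K) (Fin R) ℝ) (hKR : K ≤ R)
    (hm : m = R - K + 2) (hC : kRank C = K) :
    LinearMap.range (piSLin K m) ⊓ LinearMap.ker (Matrix.vecMulLinear (Rmat m C)) =
      LinearMap.range (Matrix.mulVecLin (krPow m (BC C))) := by
  rcases K with _ | K
  · have : IsEmpty (Fin m → Fin 0) := ⟨fun i => (i ⟨0, by omega⟩).elim0⟩
    exact Subsingleton.elim _ _
  obtain ⟨n, rfl⟩ : ∃ n, m = n + 1 := ⟨R - K, by omega⟩
  ext v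
  rw [Submodule.mem_inf, mem_range_piSLin_iff, LinearMap.mem_ker, Matrix.vecMulLinear_apply]
  constructor
  · rintro ⟨hv, h⟩
    exact mem_range_krPow_BC hC (by omega) (by omega) hv ((vecMul_Rmat_eq_zero_iff C hv).1 h)
  · rintro ⟨μ, rfl⟩
    refine ⟨mulVecLin_krPow_comp_perm _ _, (vecMul_Rmat_eq_zero_iff C
      (mulVecLin_krPow_comp_perm _ _)).2 fun j hj => ?_⟩
    rw [tensorForm_krPow]
    exact Finset.sum_eq_zero fun t _ => mul_eq_zero_of_right _
      (prod_dotProduct_BC_eq_zero hC (by omega) t hj)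
end
end
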